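/- Suppose K_n → ∞, K_n²/P_n → 0, and the sequence (n·p_{e,q}(n) − ln n)/ln ln n is bounded. Then for any constant integers m ≥ 1 and h ≥ 0, the probability that the m vertices v_1, v_2, …, v_m all have degree exactly h in 𝔾_q(n,K_n,P_n,p_n) is asymptotically equivalent, as n → ∞, to (h!)^{−m}·(n·p_{e,q}(n))^{hm}·e^{−m·n·p_{e,q}(n)}, i.e., the ratio of the two quantities tends to 1. -/

import Mathlib

open Finset Filter

/-- A configuration of the random graph `𝔾_q(n,K,P,p)`: a key-ring assignment
(one finite subset of the key pool `Fin P` per vertex) together with the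
on/off states of the channels (one Boolean per unordered pair of vertices). -/
abbrev Config (n P : ℕ) : Type := (Fin n → Finset (Fin P)) × (Sym2 (Fin n) → Bool)

/-- Probability weight of a configuration: the key rings are independent and
uniform over the `K`-element subsets of the pool of size `P`, and the channels
are independent Bernoulli(`p`). -/
noncomputable def weight (n K P : ℕ) (p : ℝ) (ω : Config n P) : ℝ :=
  (∏ i : Fin n, if (ω.1 i).card = K then ((P.choose K : ℝ))⁻¹ else 0) *
  (∏ e : Sym2 (Fin n), if ω.2 e then p else 1 - p)

/-- Probability of an event in `𝔾_q(n,K,P,p)`. -/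
noncomputable def prob (n K P : ℕ) (p : ℝ) (E : Set (Config n P)) : ℝ :=
  ∑ ω : Config n P, Set.indicator E (weight n K P p) ω

/-- Adjacency in `𝔾_q(n,K,P,p)`: two distinct vertices are adjacent iff their
key rings share at least `q` keys and the channel between them is on. -/
def Adj (q n P : ℕ) (ω : Config n P) (i j : Fin n) : Prop :=
  i ≠ j ∧ q ≤ ((ω.1 i) ∩ (ω.1 j)).card ∧ ω.2 s(i, j) = true

/-- Degree of a vertex. -/
noncomputable def degree (q n P : ℕ) (ω : Config n P) (i : Fin n) : ℕ :=
  Nat.card {j : Fin n // Adj q n P ω i j}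

/-- Minimum degree of the graph. -/
noncomputable def minDeg (q n P : ℕ) (ω : Config n P) : ℕ :=
  sInf (Set.range fun i => degree q n P ω i)

/-- `p_{s,q}`: the probability that two key rings share at least `q` keys. -/
noncomputable def psq (q K P : ℕ) : ℝ :=
  1 - ∑ u ∈ Finset.range q,
    ((K.choose u : ℝ) * ((P - K).choose (K - u) : ℝ)) / (P.choose K : ℝ)

/-- `p_{e,q}`: the probability that two distinct vertices are adjacent. -/
noncomputable def peq (q K P : ℕ) (p : ℝ) : ℝ := p * psq q K P

lemma sum_prod_comp_injective {α ε β : Type*} [Fintype α] [Fintype ε] [Fintype β]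
    [DecidableEq α] [DecidableEq ε] (ι : α → ε) (hι : Function.Injective ι)
    (w : β → ℝ) (hw : ∑ b, w b = 1) (G : (α → β) → ℝ) :
    ∑ c : ε → β, (∏ e, w (c e)) * G (c ∘ ι) = ∑ d : α → β, (∏ a, w (d a)) * G d := by
  classical
  let e₁ : ε ≃ α ⊕ {e // e ∉ Set.range ι} :=
    (Equiv.Set.sumCompl (Set.range ι)).symm.trans
      (Equiv.sumCongr (Equiv.ofInjective ι hι).symm (Equiv.refl _))
  have he : ∀ a, e₁ (ι a) = Sum.inl a := by
    intro a
    have h1 : (Equiv.Set.sumCompl (Set.range ι)).symm (ι a) = Sum.inl ⟨ι a, a, rfl⟩ :=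
      Equiv.Set.sumCompl_symm_apply_of_mem (Set.mem_range_self a)
    simp only [e₁, Equiv.trans_apply, h1, Equiv.sumCongr_apply, Sum.map_inl]
    exact congrArg Sum.inl (Equiv.ofInjective_symm_apply hι a)
  let e₂ : ((α → β) × ({e // e ∉ Set.range ι} → β)) ≃ (ε → β) :=
    (Equiv.sumArrowEquivProdArrow _ _ _).symm.trans (Equiv.arrowCongr e₁.symm (Equiv.refl _))
  rw [← e₂.sum_comp, Fintype.sum_prod_type]
  have h2 : ∀ d d', (∏ e, w (e₂ (d, d') e)) = (∏ a, w (d a)) * ∏ b, w (d' b) := by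
    intro d d'
    rw [← e₁.symm.prod_comp, Fintype.prod_sum_type]
    simp [e₂, Equiv.sumArrowEquivProdArrow]
  have h3 : ∀ d d', (e₂ (d, d')) ∘ ι = d := by
    intro d d'
    funext a
    simp [e₂, Equiv.sumArrowEquivProdArrow, he]
  simp only [h2, h3]
  refine Finset.sum_congr rfl fun d _ => ?_
  have h4 : ∑ d' : {e // e ∉ Set.range ι} → β, ∏ b, w (d' b) = 1 := by
    rw [← Fintype.prod_sum]
    simp [hw]
  calc _ = ∑ d' : {e // e ∉ Set.range ι} → β, ((∏ a, w (d a)) * G d) * ∏ b, w (d' b) :=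
        Finset.sum_congr rfl fun _ _ => by ring
    _ = _ := by rw [← Finset.mul_sum, h4, mul_one]

lemma sum_prod_pushforward {α β γ : Type*} [Fintype α] [Fintype β] [Fintype γ]
    [DecidableEq α] [DecidableEq γ] (f : β → γ) (v : β → ℝ) (Φ : (α → γ) → ℝ) :
    ∑ x : α → β, (∏ a, v (x a)) * Φ (fun a => f (x a)) =
      ∑ y : α → γ, (∏ a, ∑ b, if f b = y a then v b else 0) * Φ y := by
  classical
  have h1 : ∀ y : α → γ, (∏ a, ∑ b, if f b = y a then v b else 0) =
      ∑ x : α → β, if (fun a => f (x a)) = y then ∏ a, v (x a) else 0 := by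
    intro y
    rw [Fintype.prod_sum]
    refine Finset.sum_congr rfl fun x _ => ?_
    split_ifs with h
    · exact Finset.prod_congr rfl fun a _ => if_pos (congrFun h a)
    · obtain ⟨a, ha⟩ := Function.ne_iff.mp h
      exact Finset.prod_eq_zero (Finset.mem_univ a) (if_neg ha)
  simp only [h1, Finset.sum_mul]
  rw [Finset.sum_comm]
  refine Finset.sum_congr rfl fun x _ => ?_
  simp [ite_mul]

/-- The law of a single key ring. -/
noncomputable def ringWeight (K P : ℕ) (S : Finset (Fin P)) : ℝ :=
  if S.card = K then ((P.choose K : ℝ))⁻¹ else 0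

/-- The law of a single channel. -/
noncomputable def channelWeight (p : ℝ) (b : Bool) : ℝ := if b then p else 1 - p

lemma sum_ringWeight {K P : ℕ} (hKP : K ≤ P) : ∑ S, ringWeight K P S = 1 := by
  have h0 : (P.choose K : ℝ) ≠ 0 := by exact_mod_cast (Nat.choose_pos hKP).ne'
  have h1 : (Finset.univ.filter fun S : Finset (Fin P) => S.card = K).card = P.choose K := by
    rw [Finset.univ_filter_card_eq, Finset.card_powersetCard, Finset.card_univ, Fintype.card_fin]
  simp only [ringWeight]
  rw [← Finset.sum_filter, Finset.sum_const, h1, nsmul_eq_mul, mul_inv_cancel₀ h0]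

lemma sum_channelWeight (p : ℝ) : ∑ b, channelWeight p b = 1 := by
  simp [channelWeight]

/-- The vertices among the first `m`, with key rings `s`, to which a further vertex with
key ring `S` and channels `d` is joined. -/
def nbhd (q : ℕ) {m P : ℕ} (s : Fin m → Finset (Fin P)) (S : Finset (Fin P))
    (d : Fin m → Bool) : Finset (Fin m) :=
  Finset.univ.filter fun i => q ≤ (s i ∩ S).card ∧ d i = true

/-- The law of the neighbourhood of a further vertex in the first `m` vertices,
given their key rings `s`. -/
noncomputable def nbhdLaw (q K P : ℕ) (p : ℝ) {m : ℕ} (s : Fin m → Finset (Fin P))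
    (t : Finset (Fin m)) : ℝ :=
  ∑ y : Finset (Fin P) × (Fin m → Bool),
    if nbhd q s y.1 y.2 = t then ringWeight K P y.1 * ∏ i, channelWeight p (y.2 i) else 0

/-- The neighbourhoods in the first `m` vertices of the remaining `N` vertices. -/
def nbhds (q : ℕ) {m N P : ℕ} (ω : Config (m + N) P) (j : Fin N) : Finset (Fin m) :=
  nbhd q (fun i => ω.1 (Fin.castAdd N i)) (ω.1 (Fin.natAdd m j))
    (fun i => ω.2 s(Fin.castAdd N i, Fin.natAdd m j))

lemma sum_weight_mul (q K P : ℕ) (p : ℝ) (m N : ℕ)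
    (Φ : (Fin m → Finset (Fin P)) → (Fin N → Finset (Fin m)) → ℝ) :
    ∑ ω : Config (m + N) P, weight (m + N) K P p ω *
        Φ (fun i => ω.1 (Fin.castAdd N i)) (nbhds q ω) =
      ∑ s : Fin m → Finset (Fin P), (∏ i, ringWeight K P (s i)) *
        ∑ τ : Fin N → Finset (Fin m), (∏ j, nbhdLaw q K P p s (τ j)) * Φ s τ := by
  classical
  let ι : Fin N × Fin m → Sym2 (Fin (m + N)) := fun a => s(Fin.castAdd N a.2, Fin.natAdd m a.1)
  have hι : Function.Injective ι := by
    rintro ⟨j, i⟩ ⟨j', i'⟩ h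
    simp only [ι, Sym2.eq_iff, Fin.ext_iff, Fin.val_castAdd, Fin.val_natAdd] at h
    ext <;> simp <;> omega
  have hchan : ∀ (s : Fin m → Finset (Fin P)) (r : Fin N → Finset (Fin P)),
      ∑ c : Sym2 (Fin (m + N)) → Bool, (∏ e, channelWeight p (c e)) *
        Φ s (fun j => nbhd q s (r j) (fun i => c (ι (j, i)))) =
      ∑ d : Fin N → Fin m → Bool, (∏ j, ∏ i, channelWeight p (d j i)) *
        Φ s (fun j => nbhd q s (r j) (d j)) := by
    intro s r
    have := sum_prod_comp_injective ι hι (channelWeight p) (sum_channelWeight p)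
      (fun d : Fin N × Fin m → Bool => Φ s (fun j => nbhd q s (r j) (fun i => d (j, i))))
    simp only [Function.comp_apply] at this
    rw [this, ← (Equiv.curry (Fin N) (Fin m) Bool).symm.sum_comp]
    refine Finset.sum_congr rfl fun d _ => ?_
    rw [Fintype.prod_prod_type]
    rfl
  rw [Fintype.sum_prod_type, ← (Fin.appendEquiv m N).sum_comp, Fintype.sum_prod_type]
  refine Finset.sum_congr rfl fun s _ => ?_
  have key := sum_prod_pushforward (α := Fin N)
    (fun y : Finset (Fin P) × (Fin m → Bool) => nbhd q s y.1 y.2)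
    (fun y => ringWeight K P y.1 * ∏ i, channelWeight p (y.2 i)) (fun τ => Φ s τ)
  have : ∀ τ : Fin N → Finset (Fin m), (∏ j, nbhdLaw q K P p s (τ j)) =
    ∏ a, ∑ b : Finset (Fin P) × (Fin m → Bool), if nbhd q s b.1 b.2 = τ a then
      ringWeight K P b.1 * ∏ i, channelWeight p (b.2 i) else 0 := fun τ => rfl
  simp only [this]
  rw [← key, ← (Equiv.arrowProdEquivProdArrow (Fin N) (fun _ => Finset (Fin P))
    (fun _ => Fin m → Bool)).symm.sum_comp, Fintype.sum_prod_type, Finset.mul_sum]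
  refine Finset.sum_congr rfl fun r _ => ?_
  have h1 : ∀ c : Sym2 (Fin (m + N)) → Bool,
      weight (m + N) K P p (Fin.appendEquiv m N (s, r), c) =
      (∏ i, ringWeight K P (s i)) * (∏ j, ringWeight K P (r j)) * ∏ e, channelWeight p (c e) := by
    intro c
    simp [weight, ringWeight, channelWeight, Fin.prod_univ_add, Fin.appendEquiv]
  have h2 : ∀ c : Sym2 (Fin (m + N)) → Bool,
      Φ (fun i => Fin.appendEquiv m N (s, r) (Fin.castAdd N i))
        (nbhds q (Fin.appendEquiv m N (s, r), c)) =
      Φ s (fun j => nbhd q s (r j) (fun i => c (ι (j, i)))) := by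
    intro c
    simp only [Fin.appendEquiv, ι, Equiv.coe_fn_mk, Fin.append_left]
    congr 1
    funext j
    simp [nbhds]
  simp only [h1, h2]
  simp only [mul_assoc, ← Finset.mul_sum]
  congr 1
  rw [hchan s r, Finset.mul_sum]
  refine Finset.sum_congr rfl fun d _ => ?_
  simp [Equiv.arrowProdEquivProdArrow, Finset.prod_mul_distrib, mul_assoc]

/-- The families of pairwise disjoint `h`-element neighbourhoods of `m` vertices among `N` vertices,
recorded by the set of neighbours of each of the `N` vertices. -/
def disjointHoods (m N h : ℕ) : Finset (Fin N → Finset (Fin m)) :=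
  Finset.univ.filter fun τ =>
    (∀ j, (τ j).card ≤ 1) ∧ ∀ i, (Finset.univ.filter fun j => i ∈ τ j).card = h

lemma card_disjointHoods_mul (m N h : ℕ) :
    (disjointHoods m N h).card * (Nat.factorial h) ^ m = N.descFactorial (h * m) := by
  classical
  let F : (Fin m × Fin h ↪ Fin N) → Fin N → Finset (Fin m) :=
    fun e j => Finset.univ.filter fun i => ∃ k, e (i, k) = j
  have hF : ∀ e ∈ (Finset.univ : Finset (Fin m × Fin h ↪ Fin N)), F e ∈ disjointHoods m N h := by
    intro e _
    simp only [disjointHoods, Finset.mem_filter, Finset.mem_univ, true_and]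
    constructor
    · intro j
      rw [Finset.card_le_one]
      intro a ha b hb
      simp only [F, Finset.mem_filter, Finset.mem_univ, true_and] at ha hb
      obtain ⟨k, hk⟩ := ha
      obtain ⟨k', hk'⟩ := hb
      exact congrArg Prod.fst (e.injective (hk.trans hk'.symm))
    · intro i
      have : (Finset.univ.filter fun j => i ∈ F e j) =
          Finset.univ.map ((Function.Embedding.sectR i (Fin h)).trans e) := by
        ext j
        simp [F]
      rw [this, Finset.card_map, Finset.card_univ, Fintype.card_fin]
  have hcard : ∀ τ ∈ disjointHoods m N h,
      (Finset.univ.filter fun e => F e = τ).card = (Nat.factorial h) ^ m := by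
    intro τ hτ
    simp only [disjointHoods, Finset.mem_filter, Finset.mem_univ, true_and] at hτ
    obtain ⟨h1, h2⟩ := hτ
    have hmem : ∀ e, F e = τ → ∀ i j, i ∈ τ j ↔ ∃ k, e (i, k) = j := by
      rintro e rfl i j
      simp [F]
    let E : {e // F e = τ} ≃ ((i : Fin m) → (Fin h ≃ {j // i ∈ τ j})) :=
      { toFun := fun e i => Equiv.ofBijective
          (fun k => ⟨e.1 (i, k), (hmem e.1 e.2 i _).2 ⟨k, rfl⟩⟩) (by
            constructor
            · intro k k' hk
              exact congrArg Prod.snd (e.1.injective (congrArg Subtype.val hk))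
            · rintro ⟨j, hj⟩
              obtain ⟨k, hk⟩ := (hmem e.1 e.2 i j).1 hj
              exact ⟨k, Subtype.ext hk⟩)
        invFun := fun f => ⟨⟨fun a => (f a.1 a.2).1, by
            rintro ⟨i, k⟩ ⟨i', k'⟩ hk
            have hk : (f i k).1 = (f i' k').1 := hk
            have hi : i = i' := Finset.card_le_one.1 (h1 (f i k).1) i (f i k).2 i'
              (by rw [hk]; exact (f i' k').2)
            subst hi
            have := (f i).injective (Subtype.ext hk)
            rw [this]⟩, by
            funext j
            ext i
            simp only [F, Finset.mem_filter, Finset.mem_univ, true_and]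
            constructor
            · rintro ⟨k, rfl⟩
              exact (f i k).2
            · intro hj
              exact ⟨(f i).symm ⟨j, hj⟩, congrArg Subtype.val ((f i).apply_symm_apply ⟨j, hj⟩)⟩⟩
        left_inv := by
          intro e
          ext a
          rfl
        right_inv := by
          intro f
          funext i
          ext k
          rfl }
    rw [← Fintype.card_subtype, Fintype.card_congr E, Fintype.card_pi]
    have h3 : ∀ i, Fintype.card (Fin h ≃ {j // i ∈ τ j}) = Nat.factorial h := by
      intro i
      have h4 : Fintype.card {j // i ∈ τ j} = h := by
        rw [Fintype.card_subtype]
        exact h2 i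
      rw [Fintype.card_equiv (Fintype.equivOfCardEq (by simp [h4])), Fintype.card_fin]
    simp [h3]
  have := Finset.card_eq_sum_card_fiberwise hF
  rw [Finset.sum_congr rfl hcard, Finset.sum_const, Finset.card_univ,
    Fintype.card_embedding_eq] at this
  simp only [Fintype.card_fin, Fintype.card_prod, smul_eq_mul] at this
  rw [← this, mul_comm m h]

lemma card_nonempty_of_mem_disjointHoods {m N h : ℕ} {τ : Fin N → Finset (Fin m)}
    (hτ : τ ∈ disjointHoods m N h) :
    (Finset.univ.filter fun j => τ j ≠ ∅).card = h * m := by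
  simp only [disjointHoods, Finset.mem_filter, Finset.mem_univ, true_and] at hτ
  obtain ⟨h1, h2⟩ := hτ
  have h3 : ∑ j, (τ j).card = ∑ i : Fin m, (Finset.univ.filter fun j => i ∈ τ j).card := by
    have := Finset.sum_card_bipartiteAbove_eq_sum_card_bipartiteBelow
      (s := (Finset.univ : Finset (Fin N))) (t := (Finset.univ : Finset (Fin m)))
      (fun j i => i ∈ τ j)
    simpa [Finset.bipartiteAbove, Finset.bipartiteBelow] using this
  simp only [h2, Finset.sum_const, Finset.card_univ, Fintype.card_fin, smul_eq_mul] at h3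
  rw [Finset.card_filter, mul_comm h m, ← h3]
  refine Finset.sum_congr rfl fun j _ => ?_
  have := h1 j
  split_ifs with h
  · have := Finset.card_pos.2 (Finset.nonempty_iff_ne_empty.2 h)
    omega
  · simp only [not_not] at h
    simp [h]

lemma card_nonempty_lt_of_notMem_disjointHoods {m N h : ℕ} {τ : Fin N → Finset (Fin m)}
    (hτ : τ ∉ disjointHoods m N h) (hle : ∀ i, (Finset.univ.filter fun j => i ∈ τ j).card ≤ h) :
    (Finset.univ.filter fun j => τ j ≠ ∅).card < h * m := by
  have h3 : ∑ j, (τ j).card = ∑ i : Fin m, (Finset.univ.filter fun j => i ∈ τ j).card := by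
    have := Finset.sum_card_bipartiteAbove_eq_sum_card_bipartiteBelow
      (s := (Finset.univ : Finset (Fin N))) (t := (Finset.univ : Finset (Fin m)))
      (fun j i => i ∈ τ j)
    simpa [Finset.bipartiteAbove, Finset.bipartiteBelow] using this
  have h4 : ∑ i : Fin m, (Finset.univ.filter fun j => i ∈ τ j).card ≤ h * m := by
    calc _ ≤ ∑ i : Fin m, h := Finset.sum_le_sum fun i _ => hle i
      _ = h * m := by simp [mul_comm]
  have h5 : ∀ j, (if τ j ≠ ∅ then 1 else 0) ≤ (τ j).card := by
    intro j
    split_ifs with h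
    · exact Finset.card_pos.2 (Finset.nonempty_iff_ne_empty.2 h)
    · exact Nat.zero_le _
  rw [Finset.card_filter]
  by_cases hall : ∀ j, (τ j).card ≤ 1
  · have : ∃ i, (Finset.univ.filter fun j => i ∈ τ j).card ≠ h := by
      by_contra! hc
      exact hτ (by simp only [disjointHoods, Finset.mem_filter, Finset.mem_univ, true_and]
                   exact ⟨hall, hc⟩)
    obtain ⟨i, hi⟩ := this
    calc _ ≤ ∑ j, (τ j).card := Finset.sum_le_sum fun j _ => h5 j
      _ = _ := h3
      _ < ∑ i : Fin m, h := Finset.sum_lt_sum (fun i _ => hle i)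
        ⟨i, Finset.mem_univ _, lt_of_le_of_ne (hle i) hi⟩
      _ = h * m := by simp [mul_comm]
  · push Not at hall
    obtain ⟨j, hj⟩ := hall
    calc _ < ∑ j, (τ j).card := Finset.sum_lt_sum (fun j _ => h5 j)
          ⟨j, Finset.mem_univ _, by split_ifs <;> omega⟩
      _ = _ := h3
      _ ≤ _ := h4

lemma sum_prod_few_nonempty_le {m N R : ℕ} (π : Finset (Fin m) → ℝ) (hπ : ∀ t, 0 ≤ π t)
    (hsum : ∑ t, π t = 1) {y : ℝ} (hy : 1 ≤ y) (hNy : N * (1 - π ∅) ≤ y) :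
    ∑ τ : Fin N → Finset (Fin m), (∏ j, π (τ j)) *
        (if (Finset.univ.filter fun j => τ j ≠ ∅).card < R then 1 else 0) ≤
      R * y ^ (R - 1) * π ∅ ^ (N - R) := by
  classical
  have hle1 : π ∅ ≤ 1 := by
    rw [← hsum]
    exact Finset.single_le_sum (fun t _ => hπ t) (Finset.mem_univ ∅)
  have hne : ∑ t, (if t ≠ ∅ then π t else 0) = 1 - π ∅ := by
    rw [← hsum, eq_sub_iff_add_eq]
    have : π ∅ = ∑ t, if t = ∅ then π t else 0 := by simp
    conv_lhs => rw [this]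
    rw [← Finset.sum_add_distrib]
    refine Finset.sum_congr rfl fun t _ => ?_
    by_cases h : t = ∅ <;> simp [h]
  have key := sum_prod_pushforward (α := Fin N) (fun t : Finset (Fin m) => decide (t ≠ ∅)) π
    (fun y : Fin N → Bool =>
      if (Finset.univ.filter fun j => y j = true).card < R then (1 : ℝ) else 0)
  simp only [decide_eq_true_eq] at key
  rw [key]
  have hb : ∀ b : Bool, (∑ t, if decide (t ≠ ∅) = b then π t else 0) =
      if b = true then 1 - π ∅ else π ∅ := by
    intro b
    cases b
    · simp
    · simpa using hne
  simp only [hb]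
  let e : Finset (Fin N) ≃ (Fin N → Bool) :=
    { toFun := fun U j => decide (j ∈ U)
      invFun := fun y => Finset.univ.filter fun j => y j = true
      left_inv := fun U => by ext j; simp
      right_inv := fun y => by funext j; simp }
  have hx : 0 ≤ 1 - π ∅ := by linarith
  rw [← e.sum_comp]
  have h1 : ∀ U : Finset (Fin N), (∏ j, if e U j = true then 1 - π ∅ else π ∅) =
      (1 - π ∅) ^ U.card * π ∅ ^ (N - U.card) := by
    intro U
    simp [e, Finset.prod_ite, Finset.filter_not, ← Finset.compl_eq_univ_sdiff, Finset.card_compl]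
  have h2 : ∀ U : Finset (Fin N), (Finset.univ.filter fun j => e U j = true).card = U.card := by
    intro U
    simp [e]
  simp only [h1, h2]
  rw [← Finset.powerset_univ, Finset.sum_powerset_apply_card
    (fun r => (1 - π ∅) ^ r * π ∅ ^ (N - r) * (if r < R then (1 : ℝ) else 0)),
    Finset.card_univ, Fintype.card_fin]
  calc ∑ r ∈ Finset.range (N + 1), N.choose r •
          ((1 - π ∅) ^ r * π ∅ ^ (N - r) * (if r < R then (1 : ℝ) else 0))
      ≤ ∑ r ∈ Finset.range (N + 1), if r < R then y ^ (R - 1) * π ∅ ^ (N - R) else 0 := by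
        refine Finset.sum_le_sum fun r _ => ?_
        split_ifs with hr
        · rw [nsmul_eq_mul, mul_one, ← mul_assoc]
          refine mul_le_mul ?_ (pow_le_pow_of_le_one (hπ _) hle1 (by omega)) (pow_nonneg (hπ _) _)
            (by positivity)
          calc (N.choose r : ℝ) * (1 - π ∅) ^ r ≤ (N : ℝ) ^ r * (1 - π ∅) ^ r :=
                mul_le_mul_of_nonneg_right (by exact_mod_cast Nat.choose_le_pow N r)
                  (pow_nonneg hx _)
            _ = (N * (1 - π ∅)) ^ r := (mul_pow _ _ _).symm
            _ ≤ y ^ r := pow_le_pow_left₀ (by positivity) hNy _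
            _ ≤ y ^ (R - 1) := pow_le_pow_right₀ hy (by omega)
        · simp
    _ ≤ R * (y ^ (R - 1) * π ∅ ^ (N - R)) := by
        rw [← Finset.sum_filter, Finset.sum_const, nsmul_eq_mul]
        refine mul_le_mul_of_nonneg_right ?_ (mul_nonneg (by positivity) (pow_nonneg (hπ _) _))
        norm_cast
        calc _ ≤ (Finset.range R).card := Finset.card_le_card fun r hr => by
              simp only [Finset.mem_filter, Finset.mem_range] at hr ⊢
              exact hr.2
          _ = R := Finset.card_range R
    _ = _ := by ring

lemma ringWeight_nonneg (K P : ℕ) (S : Finset (Fin P)) : 0 ≤ ringWeight K P S := by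
  unfold ringWeight
  split_ifs <;> positivity

/-- The probability that a key ring contains `k` given keys. -/
noncomputable def inclProb (K P k : ℕ) : ℝ :=
  if k ≤ K then ((P - k).choose (K - k) : ℝ) / (P.choose K : ℝ) else 0

lemma inclProb_nonneg (K P k : ℕ) : 0 ≤ inclProb K P k := by
  unfold inclProb
  split_ifs <;> positivity

lemma sum_ringWeight_filter (K P : ℕ) (E : Finset (Fin P) → Prop) [DecidablePred E] :
    ∑ S, ringWeight K P S * (if E S then 1 else 0) =
      (((Finset.powersetCard K Finset.univ).filter E).card : ℝ) / (P.choose K : ℝ) := by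
  simp only [ringWeight, mul_ite, mul_one, mul_zero]
  rw [← Finset.sum_filter, ← Finset.sum_filter, Finset.sum_const, nsmul_eq_mul, div_eq_mul_inv]
  congr 3
  ext S
  simp [and_comm]

lemma sum_ringWeight_subset (K : ℕ) {P : ℕ} (A : Finset (Fin P)) :
    ∑ S, ringWeight K P S * (if A ⊆ S then 1 else 0) = inclProb K P A.card := by
  rw [sum_ringWeight_filter]
  unfold inclProb
  split_ifs with h
  · rw [Finset.card_filter_powersetCard_subset _ _ _ (Finset.subset_univ _) h]
    simp
  · rw [Finset.filter_false_of_mem]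
    · simp
    · intro S hS hA
      have := Finset.card_le_card hA
      rw [(Finset.mem_powersetCard.1 hS).2] at this
      exact h this

lemma inclProb_zero {K P : ℕ} (hKP : K ≤ P) : inclProb K P 0 = 1 := by
  have h0 : (P.choose K : ℝ) ≠ 0 := by exact_mod_cast (Nat.choose_pos hKP).ne'
  simp [inclProb, h0]

lemma inclProb_succ {K P k : ℕ} (hKP : K ≤ P) (hk : k + 1 ≤ K) :
    inclProb K P (k + 1) = ((K : ℝ) - k) / ((P : ℝ) - k) * inclProb K P k := by
  have h1 : ((P : ℝ) - k) ≠ 0 := by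
    have : (k : ℝ) + 1 ≤ P := by exact_mod_cast hk.trans hKP
    linarith
  unfold inclProb
  rw [if_pos hk, if_pos (by omega)]
  have h2 := Nat.add_one_mul_choose_eq (P - (k + 1)) (K - (k + 1))
  rw [show P - (k + 1) + 1 = P - k by omega, show K - (k + 1) + 1 = K - k by omega] at h2
  have h3 : ((P : ℝ) - k) * ((P - (k + 1)).choose (K - (k + 1)) : ℝ) =
      ((P - k).choose (K - k) : ℝ) * ((K : ℝ) - k) := by
    rw [← Nat.cast_sub (by omega), ← Nat.cast_sub (by omega)]
    exact_mod_cast h2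
  have h4 : ((P - (k + 1)).choose (K - (k + 1)) : ℝ) =
      ((K : ℝ) - k) / ((P : ℝ) - k) * ((P - k).choose (K - k) : ℝ) := by
    field_simp
    linarith
  rw [h4]
  ring

lemma inclProb_succ_le {K P : ℕ} (k : ℕ) (hKP : K ≤ P) :
    inclProb K P (k + 1) ≤ (K : ℝ) / P * inclProb K P k := by
  by_cases hk : k + 1 ≤ K
  · rw [inclProb_succ hKP hk]
    refine mul_le_mul_of_nonneg_right ?_ (inclProb_nonneg _ _ _)
    have h1 : (k : ℝ) + 1 ≤ K := by exact_mod_cast hk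
    have h2 : (K : ℝ) ≤ P := by exact_mod_cast hKP
    have h3 : (0 : ℝ) ≤ k := by positivity
    rw [div_le_div_iff₀ (by linarith) (by linarith)]
    nlinarith
  · rw [inclProb, if_neg hk]
    exact mul_nonneg (by positivity) (inclProb_nonneg _ _ _)

lemma inclProb_le_pow {K P : ℕ} (k : ℕ) (hKP : K ≤ P) :
    inclProb K P k ≤ ((K : ℝ) / P) ^ k := by
  induction k with
  | zero => simp [inclProb_zero hKP]
  | succ k ih =>
    rw [pow_succ']
    exact (inclProb_succ_le k hKP).trans (mul_le_mul_of_nonneg_left ih (by positivity))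

lemma pow_le_inclProb {K P q : ℕ} (k : ℕ) (hKP : K ≤ P) (hk : k ≤ q) (hq : q ≤ K) :
    (((K : ℝ) - q) / P) ^ k ≤ inclProb K P k := by
  have hqK : (q : ℝ) ≤ K := by exact_mod_cast hq
  induction k with
  | zero => simp [inclProb_zero hKP]
  | succ k ih =>
    have h1 : (k : ℝ) + 1 ≤ q := by exact_mod_cast hk
    have h2 : (K : ℝ) ≤ P := by exact_mod_cast hKP
    have h3 : (0 : ℝ) ≤ k := by positivity
    rw [pow_succ', inclProb_succ hKP (hk.trans hq)]
    refine mul_le_mul ?_ (ih (by omega)) (pow_nonneg (div_nonneg (by linarith) (by positivity)) _)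
      (div_nonneg (by linarith) (by linarith))
    exact div_le_div₀ (by linarith) (by linarith) (by linarith) (by linarith)

/-- The expected number of `q`-element sets of keys shared by two key rings. -/
noncomputable def meanShared (q K P : ℕ) : ℝ := (K.choose q : ℝ) * inclProb K P q

lemma meanShared_nonneg (q K P : ℕ) : 0 ≤ meanShared q K P :=
  mul_nonneg (by positivity) (inclProb_nonneg _ _ _)

lemma pow_le_meanShared {q K P : ℕ} (hKP : K ≤ P) (hq : 2 * q ≤ K) :
    ((K : ℝ) ^ 2 / P) ^ q ≤ 4 ^ q * Nat.factorial q * meanShared q K P := by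
  have h1 := pow_le_inclProb (q := q) q hKP le_rfl (by omega)
  have h2 : (((K + 1 - q : ℕ) : ℝ) ^ q) / Nat.factorial q ≤ K.choose q := Nat.pow_le_choose q K
  have hf : (0 : ℝ) < Nat.factorial q := by exact_mod_cast Nat.factorial_pos q
  have hq' : 2 * (q : ℝ) ≤ K := by exact_mod_cast hq
  have h3 : ((K : ℝ) / 2) ^ q ≤ Nat.factorial q * K.choose q := by
    rw [div_le_iff₀ hf] at h2
    rw [mul_comm]
    refine le_trans (pow_le_pow_left₀ (by positivity) ?_ q) h2
    rw [Nat.cast_sub (by omega)]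
    push_cast
    linarith
  have h4 : ((K : ℝ) / 2 / P) ^ q ≤ inclProb K P q := by
    refine le_trans (pow_le_pow_left₀ (by positivity) ?_ q) h1
    gcongr
    linarith
  calc ((K : ℝ) ^ 2 / P) ^ q = 4 ^ q * (((K : ℝ) / 2) ^ q * ((K : ℝ) / 2 / P) ^ q) := by
        rw [← mul_pow, ← mul_pow]
        congr 1
        ring
    _ ≤ 4 ^ q * ((Nat.factorial q * K.choose q) * inclProb K P q) := by gcongr
    _ = _ := by
      unfold meanShared
      ring

lemma card_filter_inter_card {K P : ℕ} {A : Finset (Fin P)} (hA : A.card = K) (u : ℕ) :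
    ((Finset.powersetCard K Finset.univ).filter fun S => (A ∩ S).card = u).card =
      K.choose u * (P - K).choose (K - u) := by
  by_cases hu : u ≤ K
  · have h1 : K.choose u * (P - K).choose (K - u) =
        (Finset.powersetCard u A ×ˢ Finset.powersetCard (K - u) Aᶜ).card := by
      simp [Finset.card_compl, hA]
    rw [h1]
    refine Finset.card_nbij' (fun S => (A ∩ S, Aᶜ ∩ S)) (fun B => B.1 ∪ B.2) ?_ ?_ ?_ ?_
    · intro S hS
      simp only [Finset.coe_filter, Finset.mem_powersetCard, Set.mem_ofPred_eq] at hS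
      simp only [Finset.coe_product, Set.mem_prod, Finset.mem_coe, Finset.mem_powersetCard]
      refine ⟨⟨Finset.inter_subset_left, hS.2⟩, Finset.inter_subset_left, ?_⟩
      have h2 := Finset.card_inter_add_card_sdiff S A
      have h3 : Aᶜ ∩ S = S \ A := by ext; simp [and_comm]
      rw [h3]
      rw [Finset.inter_comm] at h2
      omega
    · rintro ⟨B, D⟩ hB
      simp only [Finset.coe_product, Set.mem_prod, Finset.mem_coe, Finset.mem_powersetCard] at hB
      obtain ⟨⟨hB, hBu⟩, hD, hDu⟩ := hB
      have hd : Disjoint B D :=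
        Finset.disjoint_of_subset_left hB (Finset.disjoint_of_subset_right hD disjoint_compl_right)
      have hAD : A ∩ D = ∅ := by
        rw [← Finset.disjoint_iff_inter_eq_empty]
        exact Finset.disjoint_of_subset_right hD disjoint_compl_right
      simp only [Finset.coe_filter, Finset.mem_powersetCard, Set.mem_ofPred_eq]
      refine ⟨⟨Finset.subset_univ _, ?_⟩, ?_⟩
      · rw [Finset.card_union_of_disjoint hd]
        omega
      · rw [Finset.inter_union_distrib_left, hAD, Finset.union_empty,
          Finset.inter_eq_right.2 hB, hBu]
    · intro S _
      simp only
      rw [← Finset.union_inter_distrib_right, Finset.union_compl, Finset.univ_inter]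
    · rintro ⟨B, D⟩ hB
      simp only [Finset.coe_product, Set.mem_prod, Finset.mem_coe, Finset.mem_powersetCard] at hB
      obtain ⟨⟨hB, -⟩, hD, -⟩ := hB
      have h1 : ∀ x ∈ B, x ∈ A := fun x hx => hB hx
      have h2 : ∀ x ∈ D, x ∉ A := fun x hx => by simpa using hD hx
      ext x <;> simp only [Finset.mem_inter, Finset.mem_union, Finset.mem_compl] <;>
        have := h1 x <;> have := h2 x <;> tauto
  · rw [Nat.choose_eq_zero_of_lt (by omega), zero_mul, Finset.card_eq_zero,
      Finset.filter_false_of_mem]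
    intro S _ h
    have := Finset.card_le_card (Finset.inter_subset_left (s₁ := A) (s₂ := S))
    omega

lemma psq_eq_sum {q K P : ℕ} (hKP : K ≤ P) {A : Finset (Fin P)} (hA : A.card = K) :
    psq q K P = ∑ S, ringWeight K P S * (if q ≤ (A ∩ S).card then 1 else 0) := by
  have h1 : ∀ S : Finset (Fin P), (if q ≤ (A ∩ S).card then (1 : ℝ) else 0) =
      1 - ∑ u ∈ Finset.range q, if (A ∩ S).card = u then 1 else 0 := by
    intro S
    rw [Finset.sum_ite_eq]
    simp only [Finset.mem_range]
    by_cases h : q ≤ (A ∩ S).card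
    · rw [if_pos h, if_neg (by omega), sub_zero]
    · rw [if_neg h, if_pos (by omega), sub_self]
  simp only [h1, mul_sub, mul_one, Finset.sum_sub_distrib, sum_ringWeight hKP, Finset.mul_sum]
  rw [Finset.sum_comm]
  simp only [sum_ringWeight_filter, card_filter_inter_card hA, psq, Nat.cast_mul]

lemma meanShared_mul_le_psq {q K P : ℕ} (hKP : K ≤ P) :
    meanShared q K P * (1 - (K : ℝ) ^ 2 / P) ≤ psq q K P := by
  obtain ⟨A, -, hA⟩ := Finset.exists_subset_card_eq
    (s := (Finset.univ : Finset (Fin P))) (n := K) (by simpa using hKP)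
  rw [psq_eq_sum hKP hA]
  have hpt : ∀ S : Finset (Fin P), (∑ B ∈ Finset.powersetCard q A,
      ((if B ⊆ S then (1 : ℝ) else 0) - ∑ x ∈ A \ B, if insert x B ⊆ S then (1 : ℝ) else 0)) ≤
      if q ≤ (A ∩ S).card then (1 : ℝ) else 0 := by
    intro S
    have hterm : ∀ B ∈ Finset.powersetCard q A,
        ((if B ⊆ S then (1 : ℝ) else 0) - ∑ x ∈ A \ B, if insert x B ⊆ S then (1 : ℝ) else 0) ≤
        if B = A ∩ S then 1 else 0 := by
      intro B hB
      obtain ⟨hBA, hBq⟩ := Finset.mem_powersetCard.1 hB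
      have hnn : ∀ x ∈ A \ B, (0 : ℝ) ≤ if insert x B ⊆ S then (1 : ℝ) else 0 := by
        intro x _
        split_ifs <;> norm_num
      by_cases hBS : B ⊆ S
      · rw [if_pos hBS]
        split_ifs with heq
        · have := Finset.sum_nonneg hnn
          linarith
        · obtain ⟨x, hx, hxB⟩ : ∃ x ∈ A ∩ S, x ∉ B := by
            by_contra! hc
            exact heq (Finset.Subset.antisymm (Finset.subset_inter hBA hBS) hc)
          rw [Finset.mem_inter] at hx
          have := Finset.single_le_sum hnn (Finset.mem_sdiff.2 ⟨hx.1, hxB⟩)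
          rw [if_pos (Finset.insert_subset hx.2 hBS)] at this
          linarith
      · rw [if_neg hBS]
        have := Finset.sum_nonneg hnn
        split_ifs <;> linarith
    refine (Finset.sum_le_sum hterm).trans ?_
    rw [Finset.sum_ite_eq']
    by_cases h : q ≤ (A ∩ S).card
    · rw [if_pos h]
      split_ifs <;> norm_num
    · rw [if_neg h, if_neg]
      intro hc
      exact h (Finset.mem_powersetCard.1 hc).2.ge
  calc meanShared q K P * (1 - (K : ℝ) ^ 2 / P)
      = ∑ B ∈ Finset.powersetCard q A, inclProb K P q * (1 - K * ((K : ℝ) / P)) := by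
        rw [Finset.sum_const, Finset.card_powersetCard, hA, nsmul_eq_mul, meanShared]
        ring
    _ ≤ ∑ B ∈ Finset.powersetCard q A,
        (inclProb K P q - ∑ x ∈ A \ B, inclProb K P (q + 1)) := by
        refine Finset.sum_le_sum fun B _ => ?_
        rw [Finset.sum_const, nsmul_eq_mul]
        have h1 : ((A \ B).card : ℝ) ≤ K := by
          rw [← hA]
          exact_mod_cast Finset.card_le_card Finset.sdiff_subset
        have h2 := mul_le_mul h1 (inclProb_succ_le q hKP) (inclProb_nonneg _ _ _) (by positivity)
        nlinarith
    _ = ∑ S, ringWeight K P S * ∑ B ∈ Finset.powersetCard q A,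
        ((if B ⊆ S then (1 : ℝ) else 0) -
          ∑ x ∈ A \ B, if insert x B ⊆ S then (1 : ℝ) else 0) := by
        simp only [Finset.mul_sum, mul_sub]
        rw [Finset.sum_comm]
        refine Finset.sum_congr rfl fun B hB => ?_
        have hBq := (Finset.mem_powersetCard.1 hB).2
        rw [Finset.sum_sub_distrib, sum_ringWeight_subset, hBq, Finset.sum_comm]
        congr 1
        refine Finset.sum_congr rfl fun x hx => ?_
        rw [sum_ringWeight_subset, Finset.card_insert_of_notMem (Finset.mem_sdiff.1 hx).2, hBq]
    _ ≤ _ := Finset.sum_le_sum fun S _ =>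
        mul_le_mul_of_nonneg_left (hpt S) (ringWeight_nonneg K P S)

lemma sum_ringWeight_joint_le {q K P : ℕ} (hq : 1 ≤ q) (hKP : K ≤ P) (hK : 1 ≤ K)
    {A B : Finset (Fin P)} (hA : A.card = K) (hB : B.card = K) :
    ∑ S, ringWeight K P S * (if q ≤ (A ∩ S).card ∧ q ≤ (B ∩ S).card then 1 else 0) ≤
      meanShared q K P * (q * (A ∩ B).card / K + (K : ℝ) ^ 2 / P) := by
  have hpt : ∀ S : Finset (Fin P),
      (if q ≤ (A ∩ S).card ∧ q ≤ (B ∩ S).card then (1 : ℝ) else 0) ≤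
      ∑ D ∈ Finset.powersetCard q A, ∑ x ∈ B, if insert x D ⊆ S then (1 : ℝ) else 0 := by
    intro S
    have hnn : ∀ D ∈ Finset.powersetCard q A,
        (0 : ℝ) ≤ ∑ x ∈ B, if insert x D ⊆ S then (1 : ℝ) else 0 :=
      fun D _ => Finset.sum_nonneg fun x _ => by split_ifs <;> norm_num
    split_ifs with h
    · obtain ⟨D, hD, hDq⟩ := Finset.exists_subset_card_eq h.1
      obtain ⟨x, hx⟩ := Finset.card_pos.1 (lt_of_lt_of_le hq h.2)
      rw [Finset.mem_inter] at hx
      have hDA : D ∈ Finset.powersetCard q A :=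
        Finset.mem_powersetCard.2 ⟨hD.trans Finset.inter_subset_left, hDq⟩
      refine le_trans ?_ (Finset.single_le_sum hnn hDA)
      refine le_trans ?_ (Finset.single_le_sum (fun x _ => by split_ifs <;> norm_num) hx.1)
      rw [if_pos (Finset.insert_subset hx.2 (hD.trans Finset.inter_subset_right))]
    · exact Finset.sum_nonneg hnn
  have hcount : ∑ D ∈ Finset.powersetCard q A, ((B ∩ D).card : ℝ) =
      (A ∩ B).card * ((K - 1).choose (q - 1) : ℝ) := by
    have h1 := Finset.sum_card_bipartiteAbove_eq_sum_card_bipartiteBelow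
      (s := Finset.powersetCard q A) (t := B) (fun D x => x ∈ D)
    have h2 : ∀ D, Finset.bipartiteAbove (fun D x => x ∈ D) B D = B ∩ D := by
      intro D
      ext x
      simp [Finset.bipartiteAbove]
    have h3 : ∀ x ∈ B, (Finset.bipartiteBelow (fun D x => x ∈ D) (Finset.powersetCard q A) x).card
        = if x ∈ A then (K - 1).choose (q - 1) else 0 := by
      intro x _
      split_ifs with hx
      · have := Finset.card_filter_powersetCard_subset {x} A q
          (Finset.singleton_subset_iff.2 hx) (by simpa using hq)
        simpa [Finset.bipartiteBelow, hA] using this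
      · rw [Finset.card_eq_zero, Finset.bipartiteBelow, Finset.filter_false_of_mem]
        intro D hD hxD
        exact hx ((Finset.mem_powersetCard.1 hD).1 hxD)
    simp only [h2] at h1
    rw [Finset.sum_congr rfl h3, ← Finset.sum_filter, Finset.sum_const, smul_eq_mul,
      Finset.filter_mem_eq_inter, Finset.inter_comm B A] at h1
    exact_mod_cast h1
  have hchoose : ((K - 1).choose (q - 1) : ℝ) = q * K.choose q / K := by
    have h1 := Nat.add_one_mul_choose_eq (K - 1) (q - 1)
    rw [show K - 1 + 1 = K by omega, show q - 1 + 1 = q by omega] at h1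
    have h2 : (K : ℝ) ≠ 0 := by positivity
    rw [eq_div_iff h2, mul_comm, mul_comm (q : ℝ)]
    exact_mod_cast h1
  calc _ ≤ ∑ S, ringWeight K P S * ∑ D ∈ Finset.powersetCard q A, ∑ x ∈ B,
        (if insert x D ⊆ S then (1 : ℝ) else 0) := Finset.sum_le_sum fun S _ =>
        mul_le_mul_of_nonneg_left (hpt S) (ringWeight_nonneg K P S)
    _ = ∑ D ∈ Finset.powersetCard q A, ∑ x ∈ B, inclProb K P (insert x D).card := by
        simp only [Finset.mul_sum]
        rw [Finset.sum_comm]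
        refine Finset.sum_congr rfl fun D _ => ?_
        rw [Finset.sum_comm]
        exact Finset.sum_congr rfl fun x _ => sum_ringWeight_subset K _
    _ ≤ ∑ D ∈ Finset.powersetCard q A,
        inclProb K P q * ((B ∩ D).card + K * ((K : ℝ) / P)) := by
        refine Finset.sum_le_sum fun D hD => ?_
        have hDq := (Finset.mem_powersetCard.1 hD).2
        calc _ ≤ ∑ x ∈ B, inclProb K P q * ((if x ∈ D then 1 else 0) + (K : ℝ) / P) := by
              refine Finset.sum_le_sum fun x _ => ?_
              split_ifs with hx
              · rw [Finset.insert_eq_of_mem hx, hDq]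
                have := mul_nonneg (inclProb_nonneg K P q) (by positivity : (0 : ℝ) ≤ (K : ℝ) / P)
                linarith
              · rw [Finset.card_insert_of_notMem hx, hDq, zero_add, mul_comm]
                exact inclProb_succ_le q hKP
          _ = _ := by
              rw [← Finset.mul_sum, Finset.sum_add_distrib, Finset.sum_const, hB, nsmul_eq_mul,
                ← Finset.sum_filter, Finset.filter_mem_eq_inter]
              simp
    _ = _ := by
        rw [← Finset.mul_sum, Finset.sum_add_distrib, hcount, hchoose, Finset.sum_const,
          Finset.card_powersetCard, hA, nsmul_eq_mul, meanShared]
        ring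

lemma sum_ringWeight_exp_le {K P : ℕ} (hKP : K ≤ P) {A : Finset (Fin P)} (hA : A.card = K)
    {a : ℝ} (ha : 0 ≤ a) :
    ∑ S, ringWeight K P S * Real.exp (a * (A ∩ S).card) ≤
      Real.exp ((Real.exp a - 1) * ((K : ℝ) ^ 2 / P)) := by
  have hpos : 0 ≤ Real.exp a - 1 := by
    have := Real.one_le_exp ha
    linarith
  have hpt : ∀ S : Finset (Fin P), Real.exp (a * (A ∩ S).card) =
      ∑ B ∈ A.powerset, (Real.exp a - 1) ^ B.card * (if B ⊆ S then 1 else 0) := by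
    intro S
    have h1 := Finset.sum_pow_mul_eq_add_pow (Real.exp a - 1) 1 (A ∩ S)
    simp only [one_pow, mul_one, sub_add_cancel] at h1
    rw [mul_comm, Real.exp_nat_mul, ← h1]
    simp only [mul_ite, mul_one, mul_zero]
    rw [← Finset.sum_filter]
    refine Finset.sum_congr ?_ fun _ _ => rfl
    ext B
    rw [Finset.mem_powerset, Finset.subset_inter_iff, Finset.mem_filter, Finset.mem_powerset]
  calc _ = ∑ B ∈ A.powerset, (Real.exp a - 1) ^ B.card * inclProb K P B.card := by
        simp only [hpt, Finset.mul_sum]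
        rw [Finset.sum_comm]
        refine Finset.sum_congr rfl fun B _ => ?_
        rw [← sum_ringWeight_subset, Finset.mul_sum]
        exact Finset.sum_congr rfl fun S _ => by ring
    _ ≤ ∑ B ∈ A.powerset, ((Real.exp a - 1) * ((K : ℝ) / P)) ^ B.card * 1 ^ (A.card - B.card) := by
        refine Finset.sum_le_sum fun B _ => ?_
        rw [one_pow, mul_one, mul_pow]
        exact mul_le_mul_of_nonneg_left (inclProb_le_pow _ hKP) (pow_nonneg hpos _)
    _ = ((Real.exp a - 1) * ((K : ℝ) / P) + 1) ^ K := by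
        rw [Finset.sum_pow_mul_eq_add_pow, hA]
    _ ≤ Real.exp ((Real.exp a - 1) * ((K : ℝ) / P)) ^ K :=
        pow_le_pow_left₀ (by positivity) (Real.add_one_le_exp _) _
    _ = _ := by
        rw [← Real.exp_nat_mul]
        congr 1
        ring

lemma channelWeight_nonneg {p : ℝ} (hp0 : 0 ≤ p) (hp1 : p ≤ 1) (b : Bool) :
    0 ≤ channelWeight p b := by
  unfold channelWeight
  split_ifs <;> linarith

lemma sum_channelWeight_forall {m : ℕ} (p : ℝ) (I : Finset (Fin m)) :
    ∑ d : Fin m → Bool, (∏ i, channelWeight p (d i)) * (if ∀ i ∈ I, d i = true then 1 else 0) =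
      p ^ I.card := by
  have h1 : ∀ d : Fin m → Bool,
      (∏ i, channelWeight p (d i)) * (if ∀ i ∈ I, d i = true then 1 else 0) =
      ∏ i, channelWeight p (d i) * (if i ∈ I then (if d i = true then 1 else 0) else 1) := by
    intro d
    rw [Finset.prod_mul_distrib]
    congr 1
    split_ifs with h
    · refine (Finset.prod_eq_one fun i _ => ?_).symm
      split_ifs with h1 h2
      · rfl
      · exact absurd (h i h1) h2
      · rfl
    · push Not at h
      obtain ⟨i, hi, hd⟩ := h
      refine (Finset.prod_eq_zero (Finset.mem_univ i) ?_).symm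
      rw [if_pos hi, if_neg hd]
  simp only [h1]
  rw [← Fintype.prod_sum (fun i b => channelWeight p b *
    (if i ∈ I then (if b = true then (1 : ℝ) else 0) else 1))]
  have h2 : ∀ i, ∑ b, channelWeight p b *
      (if i ∈ I then (if b = true then (1 : ℝ) else 0) else 1) = if i ∈ I then p else 1 := by
    intro i
    split_ifs <;> simp [channelWeight]
  simp only [h2]
  rw [← Finset.prod_filter, Finset.prod_const]
  simp

section NbhdLaw

variable {q K P m : ℕ} {p : ℝ} {s : Fin m → Finset (Fin P)}

lemma nbhdLaw_nonneg (hp0 : 0 ≤ p) (hp1 : p ≤ 1) (t : Finset (Fin m)) :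
    0 ≤ nbhdLaw q K P p s t := by
  refine Finset.sum_nonneg fun y _ => ?_
  split_ifs
  · exact mul_nonneg (ringWeight_nonneg _ _ _)
      (Finset.prod_nonneg fun i _ => channelWeight_nonneg hp0 hp1 _)
  · exact le_rfl

lemma sum_nbhdLaw_mul (f : Finset (Fin m) → ℝ) :
    ∑ t, nbhdLaw q K P p s t * f t =
      ∑ S, ringWeight K P S * ∑ d, (∏ i, channelWeight p (d i)) * f (nbhd q s S d) := by
  simp only [nbhdLaw, Finset.sum_mul, ite_mul, zero_mul]
  rw [Finset.sum_comm, Fintype.sum_prod_type]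
  simp only [Finset.sum_ite_eq, Finset.mem_univ, if_true, Finset.mul_sum, mul_assoc]

lemma sum_nbhdLaw_superset (I : Finset (Fin m)) :
    ∑ t, nbhdLaw q K P p s t * (if I ⊆ t then 1 else 0) =
      p ^ I.card * ∑ S, ringWeight K P S * (if ∀ i ∈ I, q ≤ (s i ∩ S).card then 1 else 0) := by
  rw [sum_nbhdLaw_mul, Finset.mul_sum]
  refine Finset.sum_congr rfl fun S _ => ?_
  have h1 : ∀ d : Fin m → Bool, (if I ⊆ nbhd q s S d then (1 : ℝ) else 0) =
      (if ∀ i ∈ I, d i = true then 1 else 0) *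
        (if ∀ i ∈ I, q ≤ (s i ∩ S).card then 1 else 0) := by
    intro d
    rw [ite_zero_mul_ite_zero, mul_one]
    refine if_congr ?_ rfl rfl
    simp only [nbhd, Finset.subset_iff, Finset.mem_filter, Finset.mem_univ, true_and]
    constructor
    · exact fun h => ⟨fun i hi => (h hi).2, fun i hi => (h hi).1⟩
    · exact fun h i hi => ⟨h.2 i hi, h.1 i hi⟩
  simp only [h1, ← mul_assoc]
  rw [← Finset.sum_mul, sum_channelWeight_forall]
  ring

lemma sum_nbhdLaw (hKP : K ≤ P) : ∑ t, nbhdLaw q K P p s t = 1 := by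
  have := sum_nbhdLaw_superset (q := q) (K := K) (p := p) (s := s) ∅
  simpa [sum_ringWeight hKP] using this

lemma sum_nbhdLaw_mem (hKP : K ≤ P) (hs : ∀ i, (s i).card = K) (i : Fin m) :
    ∑ t, nbhdLaw q K P p s t * (if i ∈ t then 1 else 0) = peq q K P p := by
  have := sum_nbhdLaw_superset (q := q) (K := K) (p := p) (s := s) {i}
  simp only [Finset.singleton_subset_iff, Finset.card_singleton, pow_one, Finset.mem_singleton,
    forall_eq] at this
  rw [this, ← psq_eq_sum hKP (hs i), peq]

/-- An upper bound for the probability that a further vertex has two neighbours among the first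
`m` vertices, given the key rings `s` of these. -/
noncomputable def excess (q K P : ℕ) (p : ℝ) {m : ℕ} (s : Fin m → Finset (Fin P)) : ℝ :=
  ∑ a ∈ (Finset.univ : Finset (Fin m)).offDiag,
    p ^ 2 * (meanShared q K P * (q * (s a.1 ∩ s a.2).card / K + (K : ℝ) ^ 2 / P))

lemma sum_nbhdLaw_offDiag_le (hq : 1 ≤ q) (hK : 1 ≤ K) (hKP : K ≤ P)
    (hs : ∀ i, (s i).card = K) :
    ∑ t, nbhdLaw q K P p s t * (∑ a ∈ (Finset.univ : Finset (Fin m)).offDiag,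
      if a.1 ∈ t ∧ a.2 ∈ t then 1 else 0) ≤ excess q K P p s := by
  simp only [Finset.mul_sum]
  rw [Finset.sum_comm]
  refine Finset.sum_le_sum fun a ha => ?_
  have hne : a.1 ≠ a.2 := (Finset.mem_offDiag.1 ha).2.2
  have := sum_nbhdLaw_superset (q := q) (K := K) (p := p) (s := s) {a.1, a.2}
  simp only [Finset.insert_subset_iff, Finset.singleton_subset_iff, Finset.card_pair hne,
    Finset.mem_insert, Finset.mem_singleton, forall_eq_or_imp, forall_eq] at this
  rw [this]
  exact mul_le_mul_of_nonneg_left (sum_ringWeight_joint_le hq hKP hK (hs _) (hs _)) (sq_nonneg p)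

lemma sum_offDiag_mem (t : Finset (Fin m)) :
    (∑ a ∈ (Finset.univ : Finset (Fin m)).offDiag, if a.1 ∈ t ∧ a.2 ∈ t then (1 : ℝ) else 0) =
      (t.card : ℝ) * t.card - t.card := by
  rw [← Finset.sum_filter, Finset.sum_const, nsmul_eq_mul, mul_one]
  have : (Finset.univ : Finset (Fin m)).offDiag.filter (fun a => a.1 ∈ t ∧ a.2 ∈ t) =
      t.offDiag := by
    ext a
    simp only [Finset.mem_filter, Finset.mem_offDiag, Finset.mem_univ, true_and]
    tauto
  rw [this, Finset.offDiag_card, Nat.cast_sub (Nat.le_mul_self _)]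
  push_cast
  ring

lemma sum_nbhdLaw_card (hKP : K ≤ P) (hs : ∀ i, (s i).card = K) :
    ∑ t, nbhdLaw q K P p s t * (t.card : ℝ) = m * peq q K P p := by
  have h1 : ∀ t : Finset (Fin m), (t.card : ℝ) = ∑ i, if i ∈ t then (1 : ℝ) else 0 := by
    intro t
    simp
  simp only [h1, Finset.mul_sum]
  rw [Finset.sum_comm]
  simp only [sum_nbhdLaw_mem hKP hs]
  simp

lemma nbhdLaw_eq_sum (t₀ : Finset (Fin m)) :
    nbhdLaw q K P p s t₀ = ∑ t, nbhdLaw q K P p s t * (if t = t₀ then 1 else 0) := by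
  simp

lemma le_nbhdLaw_empty (hp0 : 0 ≤ p) (hp1 : p ≤ 1) (hKP : K ≤ P) (hs : ∀ i, (s i).card = K) :
    1 - m * peq q K P p ≤ nbhdLaw q K P p s ∅ := by
  rw [← sum_nbhdLaw_card (s := s) hKP hs, ← sum_nbhdLaw (q := q) (p := p) (s := s) hKP,
    nbhdLaw_eq_sum ∅, ← Finset.sum_sub_distrib]
  refine Finset.sum_le_sum fun t _ => ?_
  have h0 := nbhdLaw_nonneg (q := q) (K := K) (s := s) hp0 hp1 t
  split_ifs with h
  · simp [h]
  · have h1 : (1 : ℝ) ≤ t.card := by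
      exact_mod_cast Finset.card_pos.2 (Finset.nonempty_iff_ne_empty.2 h)
    nlinarith

lemma nbhdLaw_empty_le (hp0 : 0 ≤ p) (hp1 : p ≤ 1) (hq : 1 ≤ q) (hK : 1 ≤ K) (hKP : K ≤ P)
    (hs : ∀ i, (s i).card = K) :
    nbhdLaw q K P p s ∅ ≤ 1 - m * peq q K P p + excess q K P p s := by
  refine le_trans ?_ (add_le_add_right (sum_nbhdLaw_offDiag_le hq hK hKP hs) _)
  simp only [sum_offDiag_mem]
  rw [← sum_nbhdLaw_card (s := s) hKP hs, ← sum_nbhdLaw (q := q) (p := p) (s := s) hKP,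
    nbhdLaw_eq_sum ∅, ← Finset.sum_sub_distrib, ← Finset.sum_add_distrib]
  refine Finset.sum_le_sum fun t _ => ?_
  have h0 := nbhdLaw_nonneg (q := q) (K := K) (s := s) hp0 hp1 t
  split_ifs with h
  · simp [h]
  · have h2 := mul_nonneg h0 (sq_nonneg ((t.card : ℝ) - 1))
    linarith

lemma nbhdLaw_singleton_le (hp0 : 0 ≤ p) (hp1 : p ≤ 1) (hKP : K ≤ P)
    (hs : ∀ i, (s i).card = K) (i : Fin m) :
    nbhdLaw q K P p s {i} ≤ peq q K P p := by
  rw [← sum_nbhdLaw_mem (s := s) hKP hs i, nbhdLaw_eq_sum {i}]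
  refine Finset.sum_le_sum fun t _ => mul_le_mul_of_nonneg_left ?_ (nbhdLaw_nonneg hp0 hp1 t)
  split_ifs with h1 h2 h2
  · rfl
  · exact absurd (by simp [h1]) h2
  · norm_num
  · rfl

lemma le_nbhdLaw_singleton (hp0 : 0 ≤ p) (hp1 : p ≤ 1) (hq : 1 ≤ q) (hK : 1 ≤ K) (hKP : K ≤ P)
    (hs : ∀ i, (s i).card = K) (i : Fin m) :
    peq q K P p - excess q K P p s ≤ nbhdLaw q K P p s {i} := by
  refine le_trans (sub_le_sub_left (sum_nbhdLaw_offDiag_le hq hK hKP hs) _) ?_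
  rw [← sum_nbhdLaw_mem (s := s) hKP hs i, nbhdLaw_eq_sum {i}, ← Finset.sum_sub_distrib]
  refine Finset.sum_le_sum fun t _ => ?_
  rw [← mul_sub]
  refine mul_le_mul_of_nonneg_left ?_ (nbhdLaw_nonneg hp0 hp1 t)
  rw [sum_offDiag_mem]
  by_cases h : t = ∅
  · simp [h]
  have h1 : 1 ≤ t.card := Finset.card_pos.2 (Finset.nonempty_iff_ne_empty.2 h)
  have h1' : (1 : ℝ) ≤ t.card := by exact_mod_cast h1
  by_cases hi : i ∈ t
  · rw [if_pos hi]
    by_cases hti : t = {i}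
    · simp [hti]
    · have h2 : 2 ≤ t.card := by
        by_contra! hc
        obtain ⟨j, hj⟩ := Finset.card_eq_one.1 (show t.card = 1 by omega)
        rw [hj, Finset.mem_singleton] at hi
        exact hti (by rw [hj, hi])
      have h2' : (2 : ℝ) ≤ t.card := by exact_mod_cast h2
      rw [if_neg hti]
      nlinarith
  · rw [if_neg hi]
    split_ifs <;> nlinarith

end NbhdLaw

lemma sum_rings_pair {m K P : ℕ} (hKP : K ≤ P) {i j : Fin m} (hij : i ≠ j)
    (g : Finset (Fin P) → Finset (Fin P) → ℝ) :
    ∑ s : Fin m → Finset (Fin P), (∏ l, ringWeight K P (s l)) * g (s i) (s j) =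
      ∑ S, ringWeight K P S * ∑ S', ringWeight K P S' * g S S' := by
  have hι : Function.Injective ![i, j] := by
    intro a b
    fin_cases a <;> fin_cases b <;> simp [hij, hij.symm]
  have key := sum_prod_comp_injective ![i, j] hι (ringWeight K P) (sum_ringWeight hKP)
    (fun d => g (d 0) (d 1))
  simp only [Function.comp_apply, Matrix.cons_val_zero, Matrix.cons_val_one] at key
  rw [key, ← (finTwoArrowEquiv (Finset (Fin P))).symm.sum_comp, Fintype.sum_prod_type]
  simp [finTwoArrowEquiv, Finset.mul_sum, mul_assoc]

lemma sum_rings {m K P : ℕ} (hKP : K ≤ P) :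
    ∑ s : Fin m → Finset (Fin P), ∏ l, ringWeight K P (s l) = 1 := by
  rw [← Fintype.prod_sum (fun _ => ringWeight K P)]
  simp [sum_ringWeight hKP]

lemma prod_ringWeight_nonneg {m K P : ℕ} (s : Fin m → Finset (Fin P)) :
    0 ≤ ∏ l, ringWeight K P (s l) :=
  Finset.prod_nonneg fun _ _ => ringWeight_nonneg _ _ _

lemma sum_rings_exp_pair_le {m K P : ℕ} (hKP : K ≤ P) {i j : Fin m} (hij : i ≠ j)
    {a : ℝ} (ha : 0 ≤ a) :
    ∑ s : Fin m → Finset (Fin P), (∏ l, ringWeight K P (s l)) *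
        Real.exp (a * (s i ∩ s j).card) ≤
      Real.exp ((Real.exp a - 1) * ((K : ℝ) ^ 2 / P)) := by
  rw [sum_rings_pair hKP hij (fun S S' => Real.exp (a * (S ∩ S').card))]
  calc _ ≤ ∑ S, ringWeight K P S * Real.exp ((Real.exp a - 1) * ((K : ℝ) ^ 2 / P)) := by
        refine Finset.sum_le_sum fun S _ => ?_
        by_cases hS : S.card = K
        · exact mul_le_mul_of_nonneg_left (sum_ringWeight_exp_le hKP hS ha)
            (ringWeight_nonneg _ _ _)
        · simp [ringWeight, hS]
    _ = _ := by rw [← Finset.sum_mul, sum_ringWeight hKP, one_mul]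

lemma exp_sum_le_one_add {α : Type*} (T : Finset α) {f : α → ℝ} (hf : ∀ a ∈ T, 0 ≤ f a) {B : ℝ}
    (hB : (T.card : ℝ) ≤ B) :
    Real.exp (∑ a ∈ T, f a) ≤ 1 + ∑ a ∈ T, (Real.exp (B * f a) - 1) := by
  have hB0 : 0 ≤ B := le_trans (by positivity) hB
  have hnn : ∀ a ∈ T, 0 ≤ Real.exp (B * f a) - 1 := fun a ha => by
    have := Real.one_le_exp (mul_nonneg hB0 (hf a ha))
    linarith
  rcases T.eq_empty_or_nonempty with rfl | hT
  · simp
  · obtain ⟨b, hb, hmax⟩ := Finset.exists_max_image T f hT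
    have h1 : ∑ a ∈ T, f a ≤ B * f b := by
      calc _ ≤ ∑ a ∈ T, f b := Finset.sum_le_sum hmax
        _ = T.card * f b := by rw [Finset.sum_const, nsmul_eq_mul]
        _ ≤ _ := mul_le_mul_of_nonneg_right hB (hf b hb)
    have h2 := Finset.single_le_sum hnn hb
    have h3 := Real.exp_le_exp.2 h1
    linarith

lemma card_offDiag_univ_le (m : ℕ) :
    ((Finset.univ : Finset (Fin m)).offDiag.card : ℝ) ≤ (m : ℝ) ^ 2 := by
  rw [Finset.offDiag_card, Finset.card_univ, Fintype.card_fin, sq]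
  exact_mod_cast Nat.sub_le _ _

lemma sum_rings_sum_offDiag_le {m K P : ℕ} (hKP : K ≤ P) {a : ℝ} (ha : 0 ≤ a) :
    ∑ s : Fin m → Finset (Fin P), (∏ l, ringWeight K P (s l)) *
        ∑ b ∈ (Finset.univ : Finset (Fin m)).offDiag,
          (Real.exp (a * (s b.1 ∩ s b.2).card) - 1) ≤
      (m : ℝ) ^ 2 * (Real.exp ((Real.exp a - 1) * ((K : ℝ) ^ 2 / P)) - 1) := by
  have hnn : 0 ≤ Real.exp ((Real.exp a - 1) * ((K : ℝ) ^ 2 / P)) - 1 := by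
    have h1 := Real.one_le_exp ha
    have := Real.one_le_exp (mul_nonneg (sub_nonneg.2 h1)
      (by positivity : (0 : ℝ) ≤ (K : ℝ) ^ 2 / P))
    linarith
  simp only [Finset.mul_sum]
  rw [Finset.sum_comm]
  calc _ ≤ ∑ b ∈ (Finset.univ : Finset (Fin m)).offDiag,
        (Real.exp ((Real.exp a - 1) * ((K : ℝ) ^ 2 / P)) - 1) := by
        refine Finset.sum_le_sum fun b hb => ?_
        simp only [mul_sub, mul_one, Finset.sum_sub_distrib]
        rw [sum_rings hKP]
        exact sub_le_sub_right (sum_rings_exp_pair_le hKP (Finset.mem_offDiag.1 hb).2.2 ha) _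
    _ ≤ _ := by
        rw [Finset.sum_const, nsmul_eq_mul]
        exact mul_le_mul_of_nonneg_right (card_offDiag_univ_le m) hnn

lemma sum_rings_exp_sum_le {m K P : ℕ} (hKP : K ≤ P) {a : ℝ} (ha : 0 ≤ a) :
    ∑ s : Fin m → Finset (Fin P), (∏ l, ringWeight K P (s l)) *
        Real.exp (∑ b ∈ (Finset.univ : Finset (Fin m)).offDiag, a * (s b.1 ∩ s b.2).card) ≤
      1 + (m : ℝ) ^ 2 *
        (Real.exp ((Real.exp ((m : ℝ) ^ 2 * a) - 1) * ((K : ℝ) ^ 2 / P)) - 1) := by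
  refine le_trans ?_ (add_le_add_right
    (sum_rings_sum_offDiag_le hKP (by positivity : 0 ≤ (m : ℝ) ^ 2 * a)) 1)
  rw [← sum_rings (m := m) hKP, ← Finset.sum_add_distrib]
  refine Finset.sum_le_sum fun s _ => ?_
  rw [← mul_one_add]
  refine mul_le_mul_of_nonneg_left ?_ (prod_ringWeight_nonneg s)
  have := exp_sum_le_one_add (Finset.univ : Finset (Fin m)).offDiag
    (f := fun b => a * ((s b.1 ∩ s b.2).card : ℝ)) (fun b _ => by positivity)
    (card_offDiag_univ_le m)
  simpa only [mul_assoc, sum_rings hKP] using this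

lemma le_sum_rings_disjoint {m K P : ℕ} (hKP : K ≤ P) :
    1 - (m : ℝ) ^ 2 * (Real.exp ((Real.exp 1 - 1) * ((K : ℝ) ^ 2 / P)) - 1) ≤
      ∑ s : Fin m → Finset (Fin P), (∏ l, ringWeight K P (s l)) *
        (if ∀ i j, i ≠ j → s i ∩ s j = ∅ then 1 else 0) := by
  refine le_trans (sub_le_sub_left (sum_rings_sum_offDiag_le hKP zero_le_one) 1) ?_
  rw [← sum_rings (m := m) hKP, ← Finset.sum_sub_distrib]
  refine Finset.sum_le_sum fun s _ => ?_
  rw [← mul_one_sub]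
  refine mul_le_mul_of_nonneg_left ?_ (prod_ringWeight_nonneg s)
  rw [sum_rings hKP]
  have hnn : ∀ b ∈ (Finset.univ : Finset (Fin m)).offDiag,
      0 ≤ Real.exp (1 * ((s b.1 ∩ s b.2).card : ℝ)) - 1 := fun b _ => by
    have := Real.one_le_exp (by positivity : (0 : ℝ) ≤ 1 * ((s b.1 ∩ s b.2).card : ℝ))
    linarith
  split_ifs with h
  · have := Finset.sum_nonneg hnn
    linarith
  · push Not at h
    obtain ⟨i, j, hij, hne⟩ := h
    have h1 := Finset.single_le_sum hnn (a := (i, j))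
      (Finset.mem_offDiag.2 ⟨Finset.mem_univ i, Finset.mem_univ j, hij⟩)
    have h2 : (1 : ℝ) ≤ (s i ∩ s j).card := by
      exact_mod_cast Finset.card_pos.2 hne
    have h3 := Real.add_one_le_exp (1 * ((s i ∩ s j).card : ℝ))
    simp only at h1
    linarith

lemma adj_castAdd_natAdd {q m N P : ℕ} (ω : Config (m + N) P) (i : Fin m) (j : Fin N) :
    Adj q (m + N) P ω (Fin.castAdd N i) (Fin.natAdd m j) ↔ i ∈ nbhds q ω j := by
  have hne : Fin.castAdd N i ≠ Fin.natAdd m j := by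
    intro h
    have := congrArg Fin.val h
    simp at this
    omega
  simp [Adj, nbhds, nbhd, hne]

lemma card_le_degree {q m N P : ℕ} (ω : Config (m + N) P) (i : Fin m) :
    (Finset.univ.filter fun j => i ∈ nbhds q ω j).card ≤
      degree q (m + N) P ω (Fin.castAdd N i) := by
  classical
  rw [← Fintype.card_subtype, ← Nat.card_eq_fintype_card, degree]
  refine Nat.card_le_card_of_injective
    (fun j => ⟨Fin.natAdd m j.1, (adj_castAdd_natAdd ω i j.1).2 j.2⟩) ?_
  intro j j' h
  have := congrArg (fun v => v.1) h
  exact Subtype.ext (Fin.natAdd_injective _ _ this)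

lemma degree_eq_card {q m N P : ℕ} (hq : 1 ≤ q) (ω : Config (m + N) P)
    (hdisj : ∀ i j : Fin m, i ≠ j → ω.1 (Fin.castAdd N i) ∩ ω.1 (Fin.castAdd N j) = ∅)
    (i : Fin m) :
    degree q (m + N) P ω (Fin.castAdd N i) =
      (Finset.univ.filter fun j => i ∈ nbhds q ω j).card := by
  classical
  rw [← Fintype.card_subtype, ← Nat.card_eq_fintype_card, degree]
  refine (Nat.card_eq_of_bijective
    (fun j : {j // i ∈ nbhds q ω j} =>
      (⟨Fin.natAdd m j.1, (adj_castAdd_natAdd ω i j.1).2 j.2⟩ :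
        {v // Adj q (m + N) P ω (Fin.castAdd N i) v})) ⟨?_, ?_⟩).symm
  · intro j j' h
    have := congrArg (fun v => v.1) h
    exact Subtype.ext (Fin.natAdd_injective _ _ this)
  · rintro ⟨v, hv⟩
    induction v using Fin.addCases with
    | left i' =>
      obtain ⟨h1, h2, -⟩ := hv
      rw [hdisj i i' (fun h => h1 (by rw [h])), Finset.card_empty] at h2
      omega
    | right j => exact ⟨⟨j, (adj_castAdd_natAdd ω i j).1 hv⟩, rfl⟩

lemma weight_nonneg {n K P : ℕ} {p : ℝ} (hp0 : 0 ≤ p) (hp1 : p ≤ 1) (ω : Config n P) :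
    0 ≤ weight n K P p ω :=
  mul_nonneg (Finset.prod_nonneg fun _ _ => ringWeight_nonneg _ _ _)
    (Finset.prod_nonneg fun _ _ => channelWeight_nonneg hp0 hp1 _)

section Bounds

variable {q K P m N h : ℕ} {p : ℝ}

lemma meanShared_le_two_mul (hKP : K ≤ P) (hx : (K : ℝ) ^ 2 / P ≤ 1 / 2) :
    meanShared q K P ≤ 2 * psq q K P := by
  have h1 := meanShared_mul_le_psq (q := q) hKP
  have h2 := meanShared_nonneg q K P
  nlinarith

lemma psq_nonneg (hKP : K ≤ P) : 0 ≤ psq q K P := by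
  obtain ⟨A, -, hA⟩ := Finset.exists_subset_card_eq
    (s := (Finset.univ : Finset (Fin P))) (n := K) (by simpa using hKP)
  rw [psq_eq_sum hKP hA]
  refine Finset.sum_nonneg fun S _ => mul_nonneg (ringWeight_nonneg _ _ _) ?_
  split_ifs <;> norm_num

lemma prod_ite_nonempty {τ : Fin N → Finset (Fin m)} (hτ : τ ∈ disjointHoods m N h) (x y : ℝ) :
    ∏ j, (if τ j ≠ ∅ then x else y) = x ^ (h * m) * y ^ (N - h * m) := by
  rw [Finset.prod_ite, Finset.prod_const, Finset.prod_const, card_nonempty_of_mem_disjointHoods hτ,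
    Finset.filter_not (fun j => τ j ≠ ∅) Finset.univ, Finset.card_sdiff_of_subset
      (Finset.filter_subset _ _), card_nonempty_of_mem_disjointHoods hτ, Finset.card_univ,
    Fintype.card_fin]

lemma exists_eq_singleton_of_mem_disjointHoods {τ : Fin N → Finset (Fin m)}
    (hτ : τ ∈ disjointHoods m N h) {j : Fin N} (hj : τ j ≠ ∅) : ∃ i, τ j = {i} := by
  simp only [disjointHoods, Finset.mem_filter, Finset.mem_univ, true_and] at hτ
  have h1 := hτ.1 j
  have h2 := Finset.card_pos.2 (Finset.nonempty_iff_ne_empty.2 hj)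
  exact Finset.card_eq_one.1 (by omega)

lemma card_disjointHoods_real :
    ((disjointHoods m N h).card : ℝ) =
      ((Nat.factorial h : ℝ) ^ m)⁻¹ * (N.descFactorial (h * m) : ℝ) := by
  have hf : ((Nat.factorial h : ℝ) ^ m) ≠ 0 := by positivity
  rw [eq_inv_mul_iff_mul_eq₀ hf, mul_comm]
  exact_mod_cast card_disjointHoods_mul m N h

lemma sum_prod_nbhdLaw_le {s : Fin m → Finset (Fin P)} (hp0 : 0 ≤ p) (hp1 : p ≤ 1)
    (hKP : K ≤ P) (hs : ∀ i, (s i).card = K)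
    (hy : 1 ≤ (m : ℝ) * (((m + N : ℕ) : ℝ) * peq q K P p)) :
    ∑ τ : Fin N → Finset (Fin m), (∏ j, nbhdLaw q K P p s (τ j)) *
        ((if τ ∈ disjointHoods m N h then 1 else 0) +
          (if (Finset.univ.filter fun j => τ j ≠ ∅).card < h * m then 1 else 0)) ≤
      (((Nat.factorial h : ℝ) ^ m)⁻¹ * (((m + N : ℕ) : ℝ) * peq q K P p) ^ (h * m) +
        (h * m : ℕ) * ((m : ℝ) * (((m + N : ℕ) : ℝ) * peq q K P p)) ^ (h * m - 1)) *
        nbhdLaw q K P p s ∅ ^ (N - h * m) := by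
  have hpe : 0 ≤ peq q K P p := mul_nonneg hp0 (psq_nonneg hKP)
  have hπ := nbhdLaw_nonneg (q := q) (K := K) (s := s) hp0 hp1
  have hN : (N : ℝ) ≤ ((m + N : ℕ) : ℝ) := by exact_mod_cast Nat.le_add_left N m
  simp only [mul_add, Finset.sum_add_distrib]
  rw [add_mul]
  refine add_le_add ?_ ?_
  · simp only [mul_ite, mul_one, mul_zero]
    rw [← Finset.sum_filter, Finset.filter_mem_eq_inter, Finset.univ_inter]
    calc _ ≤ ∑ τ ∈ disjointHoods m N h,
          peq q K P p ^ (h * m) * nbhdLaw q K P p s ∅ ^ (N - h * m) := by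
          refine Finset.sum_le_sum fun τ hτ => ?_
          rw [← prod_ite_nonempty hτ]
          refine Finset.prod_le_prod (fun j _ => hπ _) fun j _ => ?_
          split_ifs with hj
          · obtain ⟨i, hi⟩ := exists_eq_singleton_of_mem_disjointHoods hτ hj
            rw [hi]
            exact nbhdLaw_singleton_le hp0 hp1 hKP hs i
          · rw [not_not.1 hj]
      _ = ((Nat.factorial h : ℝ) ^ m)⁻¹ * ((N.descFactorial (h * m) : ℝ) * peq q K P p ^ (h * m)) *
          nbhdLaw q K P p s ∅ ^ (N - h * m) := by
          rw [Finset.sum_const, nsmul_eq_mul, card_disjointHoods_real]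
          ring
      _ ≤ _ := by
          rw [mul_pow]
          refine mul_le_mul_of_nonneg_right (mul_le_mul_of_nonneg_left
            (mul_le_mul_of_nonneg_right ?_ (pow_nonneg hpe _)) (by positivity))
            (pow_nonneg (hπ _) _)
          exact_mod_cast (Nat.descFactorial_le_pow N (h * m)).trans
            (Nat.pow_le_pow_left (Nat.le_add_left N m) _)
  · refine sum_prod_few_nonempty_le _ hπ (sum_nbhdLaw hKP) hy ?_
    have h1 := le_nbhdLaw_empty (q := q) (K := K) (s := s) hp0 hp1 hKP hs
    calc (N : ℝ) * (1 - nbhdLaw q K P p s ∅) ≤ ((m + N : ℕ) : ℝ) * (m * peq q K P p) :=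
          mul_le_mul hN (by linarith) (by
            have := Finset.single_le_sum (fun t _ => hπ t) (Finset.mem_univ ∅)
            rw [sum_nbhdLaw hKP] at this
            linarith) (by positivity)
      _ = _ := by ring

lemma excess_le (hp0 : 0 ≤ p) (hKP : K ≤ P) (hx : (K : ℝ) ^ 2 / P ≤ 1 / 2)
    (s : Fin m → Finset (Fin P)) :
    excess q K P p s ≤ 2 * p * peq q K P p * (m ^ 2 * ((K : ℝ) ^ 2 / P)) +
      ∑ b ∈ (Finset.univ : Finset (Fin m)).offDiag,
        2 * p * peq q K P p * q / K * (s b.1 ∩ s b.2).card := by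
  have h1 := meanShared_le_two_mul (q := q) hKP hx
  have hpe : 0 ≤ peq q K P p := mul_nonneg hp0 (psq_nonneg hKP)
  calc excess q K P p s ≤ ∑ b ∈ (Finset.univ : Finset (Fin m)).offDiag,
        (2 * p * peq q K P p * ((K : ℝ) ^ 2 / P) +
          2 * p * peq q K P p * q / K * (s b.1 ∩ s b.2).card) := by
        refine Finset.sum_le_sum fun b _ => ?_
        calc _ ≤ p ^ 2 * (2 * psq q K P * (q * (s b.1 ∩ s b.2).card / K + (K : ℝ) ^ 2 / P)) := by
              gcongr
          _ = _ := by
              unfold peq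
              ring
    _ ≤ _ := by
        rw [Finset.sum_add_distrib, Finset.sum_const, nsmul_eq_mul]
        refine add_le_add_left ?_ _
        have := mul_le_mul_of_nonneg_right (card_offDiag_univ_le m)
          (by positivity : 0 ≤ 2 * p * peq q K P p * ((K : ℝ) ^ 2 / P))
        linarith

lemma prob_degree_le (hq : 1 ≤ q) (hK : 1 ≤ K) (hKP : K ≤ P) (hp0 : 0 ≤ p) (hp1 : p ≤ 1)
    (hx : (K : ℝ) ^ 2 / P ≤ 1 / 2) (hN : h * m ≤ N) {l : ℝ}
    (hl : l = ((m + N : ℕ) : ℝ) * peq q K P p) (hy : 1 ≤ (m : ℝ) * l) :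
    prob (m + N) K P p {ω | ∀ i : Fin (m + N), (i : ℕ) < m → degree q (m + N) P ω i = h} ≤
      (((Nat.factorial h : ℝ) ^ m)⁻¹ * l ^ (h * m) + (h * m : ℕ) * (m * l) ^ (h * m - 1)) *
      (Real.exp (-(m * l) + (m + (h * m : ℕ)) * (m * peq q K P p) +
        2 * p * l * (m ^ 2 * ((K : ℝ) ^ 2 / P))) *
      (1 + (m : ℝ) ^ 2 * (Real.exp ((Real.exp ((m : ℝ) ^ 2 * (2 * p * l * q / K)) - 1) *
        ((K : ℝ) ^ 2 / P)) - 1))) := by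
  classical
  have hpe : 0 ≤ peq q K P p := mul_nonneg hp0 (psq_nonneg hKP)
  have hl0 : 0 ≤ l := by rw [hl]; positivity
  set C : ℝ := ((Nat.factorial h : ℝ) ^ m)⁻¹ * l ^ (h * m) + (h * m : ℕ) * (m * l) ^ (h * m - 1)
    with hC
  set D : ℝ := -(m * l) + (m + (h * m : ℕ)) * (m * peq q K P p) +
        2 * p * l * (m ^ 2 * ((K : ℝ) ^ 2 / P)) with hD
  have hC0 : 0 ≤ C := by positivity
  let Φ : (Fin N → Finset (Fin m)) → ℝ := fun τ =>
    (if τ ∈ disjointHoods m N h then 1 else 0) +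
      (if (Finset.univ.filter fun j => τ j ≠ ∅).card < h * m then 1 else 0)
  have hΦ : ∀ τ, 0 ≤ Φ τ := fun τ => by
    simp only [Φ]
    split_ifs <;> norm_num
  calc _ ≤ ∑ ω : Config (m + N) P, weight (m + N) K P p ω * Φ (nbhds q ω) := by
        refine Finset.sum_le_sum fun ω _ => ?_
        have hw := weight_nonneg (K := K) hp0 hp1 ω
        by_cases hω : ω ∈ {ω : Config (m + N) P |
            ∀ i : Fin (m + N), (i : ℕ) < m → degree q (m + N) P ω i = h}
        · rw [Set.indicator_of_mem hω]
          have h1 : 1 ≤ Φ (nbhds q ω) := by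
            by_cases hmem : nbhds q ω ∈ disjointHoods m N h
            · simp only [Φ, if_pos hmem]
              split_ifs <;> norm_num
            · have := card_nonempty_lt_of_notMem_disjointHoods hmem fun i =>
                (card_le_degree ω i).trans (hω (Fin.castAdd N i) (by simp)).le
              simp only [Φ, if_neg hmem, if_pos this]
              norm_num
          nlinarith
        · rw [Set.indicator_of_notMem hω]
          exact mul_nonneg hw (hΦ _)
    _ = _ := sum_weight_mul q K P p m N (fun _ τ => Φ τ)
    _ ≤ ∑ s : Fin m → Finset (Fin P), (∏ i, ringWeight K P (s i)) *
        (C * (Real.exp D * Real.exp (∑ b ∈ (Finset.univ : Finset (Fin m)).offDiag,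
          2 * p * l * q / K * (s b.1 ∩ s b.2).card))) := by
        refine Finset.sum_le_sum fun s _ => ?_
        by_cases hs : ∀ i, (s i).card = K
        · refine mul_le_mul_of_nonneg_left ?_ (prod_ringWeight_nonneg s)
          refine (sum_prod_nbhdLaw_le hp0 hp1 hKP hs (by rw [← hl]; exact hy)).trans ?_
          rw [← hl]
          refine mul_le_mul_of_nonneg_left ?_ hC0
          set ε := excess q K P p s with hε
          have hε0 : 0 ≤ ε := Finset.sum_nonneg fun b _ => by
            have := meanShared_nonneg q K P
            positivity
          have h1 : nbhdLaw q K P p s ∅ ≤ Real.exp (-(m * peq q K P p - ε)) := by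
            have h2 := nbhdLaw_empty_le (s := s) hp0 hp1 hq hK hKP hs
            have h3 := Real.add_one_le_exp (-(m * peq q K P p - ε))
            linarith
          refine (pow_le_pow_left₀ (nbhdLaw_nonneg hp0 hp1 _) h1 _).trans ?_
          rw [← Real.exp_nat_mul, ← Real.exp_add, Real.exp_le_exp, Nat.cast_sub hN]
          have h4 := mul_le_mul_of_nonneg_left (excess_le (q := q) (m := m) hp0 hKP hx s)
            (by positivity : (0 : ℝ) ≤ ((m + N : ℕ) : ℝ))
          rw [mul_add, Finset.mul_sum] at h4
          have h5 : ∑ b ∈ (Finset.univ : Finset (Fin m)).offDiag,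
              2 * p * l * q / K * ((s b.1 ∩ s b.2).card : ℝ) =
              ∑ b ∈ (Finset.univ : Finset (Fin m)).offDiag, ((m + N : ℕ) : ℝ) *
                (2 * p * peq q K P p * q / K * (s b.1 ∩ s b.2).card) :=
            Finset.sum_congr rfl fun b _ => by rw [hl]; ring
          have h6 : ((m + N : ℕ) : ℝ) * (2 * p * peq q K P p * (m ^ 2 * ((K : ℝ) ^ 2 / P))) =
              2 * p * l * (m ^ 2 * ((K : ℝ) ^ 2 / P)) := by rw [hl]; ring
          have h7 : ((N : ℝ) - (h * m : ℕ)) * -(m * peq q K P p - ε) ≤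
              -(m * l) + (m + (h * m : ℕ)) * (m * peq q K P p) + ((m + N : ℕ) : ℝ) * ε := by
            have : 0 ≤ ((m : ℝ) + (h * m : ℕ)) * ε := by positivity
            rw [hl]
            push_cast at this ⊢
            nlinarith
          rw [h5, hD]
          linarith
        · push Not at hs
          obtain ⟨i, hi⟩ := hs
          have : ∏ i, ringWeight K P (s i) = 0 :=
            Finset.prod_eq_zero (Finset.mem_univ i) (by simp [ringWeight, hi])
          simp [this]
    _ = C * (Real.exp D * ∑ s : Fin m → Finset (Fin P), (∏ i, ringWeight K P (s i)) *
        Real.exp (∑ b ∈ (Finset.univ : Finset (Fin m)).offDiag,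
          2 * p * l * q / K * (s b.1 ∩ s b.2).card)) := by
        rw [Finset.mul_sum, Finset.mul_sum]
        exact Finset.sum_congr rfl fun s _ => by ring
    _ ≤ _ := by
        refine mul_le_mul_of_nonneg_left (mul_le_mul_of_nonneg_left ?_ (Real.exp_pos _).le) hC0
        exact sum_rings_exp_sum_le hKP (by positivity)

lemma le_prob_degree (hq : 1 ≤ q) (hK : 1 ≤ K) (hKP : K ≤ P) (hp0 : 0 ≤ p) (hp1 : p ≤ 1)
    (hx : (K : ℝ) ^ 2 / P ≤ 1 / 2) (hx' : 2 * m ^ 2 * ((K : ℝ) ^ 2 / P) ≤ 1)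
    (hmp : m * peq q K P p ≤ 1) (hN : h * m ≤ N) :
    ((Nat.factorial h : ℝ) ^ m)⁻¹ * ((N : ℝ) - (h * m : ℕ)) ^ (h * m) *
      (peq q K P p * (1 - 2 * m ^ 2 * ((K : ℝ) ^ 2 / P))) ^ (h * m) *
      (1 - m * peq q K P p) ^ N *
      (1 - (m : ℝ) ^ 2 * (Real.exp ((Real.exp 1 - 1) * ((K : ℝ) ^ 2 / P)) - 1)) ≤
    prob (m + N) K P p {ω | ∀ i : Fin (m + N), (i : ℕ) < m → degree q (m + N) P ω i = h} := by
  classical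
  have hpe : 0 ≤ peq q K P p := mul_nonneg hp0 (psq_nonneg hKP)
  set x : ℝ := (K : ℝ) ^ 2 / P with hxdef
  have hx0 : 0 ≤ x := by positivity
  set B : ℝ := ((Nat.factorial h : ℝ) ^ m)⁻¹ * ((N : ℝ) - (h * m : ℕ)) ^ (h * m) *
      (peq q K P p * (1 - 2 * m ^ 2 * x)) ^ (h * m) * (1 - m * peq q K P p) ^ N with hB
  have hNR : (0 : ℝ) ≤ (N : ℝ) - (h * m : ℕ) := sub_nonneg.2 (by exact_mod_cast hN)
  have hb1 : 0 ≤ peq q K P p * (1 - 2 * m ^ 2 * x) := mul_nonneg hpe (by linarith)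
  have hb0 : 0 ≤ 1 - m * peq q K P p := by linarith
  have hb0' : 1 - m * peq q K P p ≤ 1 := by
    have : 0 ≤ m * peq q K P p := by positivity
    linarith
  have hB0 : 0 ≤ B := by positivity
  let Φ : (Fin m → Finset (Fin P)) → (Fin N → Finset (Fin m)) → ℝ := fun s τ =>
    if (∀ i j, i ≠ j → s i ∩ s j = ∅) ∧ τ ∈ disjointHoods m N h then 1 else 0
  calc _ ≤ B * ∑ s : Fin m → Finset (Fin P), (∏ i, ringWeight K P (s i)) *
        (if ∀ i j, i ≠ j → s i ∩ s j = ∅ then 1 else 0) :=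
        mul_le_mul_of_nonneg_left (le_sum_rings_disjoint hKP) hB0
    _ = ∑ s : Fin m → Finset (Fin P), (∏ i, ringWeight K P (s i)) *
        (B * (if ∀ i j, i ≠ j → s i ∩ s j = ∅ then 1 else 0)) := by
        rw [Finset.mul_sum]
        exact Finset.sum_congr rfl fun s _ => by ring
    _ ≤ ∑ s : Fin m → Finset (Fin P), (∏ i, ringWeight K P (s i)) *
        ∑ τ : Fin N → Finset (Fin m), (∏ j, nbhdLaw q K P p s (τ j)) * Φ s τ := by
        refine Finset.sum_le_sum fun s _ => ?_
        by_cases hs : ∀ i, (s i).card = K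
        · refine mul_le_mul_of_nonneg_left ?_ (prod_ringWeight_nonneg s)
          have hπ := nbhdLaw_nonneg (q := q) (K := K) (s := s) hp0 hp1
          by_cases hd : ∀ i j, i ≠ j → s i ∩ s j = ∅
          · rw [if_pos hd, mul_one]
            have hε : excess q K P p s ≤ peq q K P p * (2 * m ^ 2 * x) := by
              refine (excess_le hp0 hKP hx s).trans ?_
              rw [Finset.sum_eq_zero, add_zero]
              · have : p * (2 * peq q K P p * (m ^ 2 * x)) ≤ 1 * (2 * peq q K P p * (m ^ 2 * x)) :=
                  mul_le_mul_of_nonneg_right hp1 (by positivity)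
                linarith
              · intro b hb
                rw [hd _ _ (Finset.mem_offDiag.1 hb).2.2]
                simp
            have h1 : ∀ i, peq q K P p * (1 - 2 * m ^ 2 * x) ≤ nbhdLaw q K P p s {i} := fun i => by
              have := le_nbhdLaw_singleton (s := s) hp0 hp1 hq hK hKP hs i
              linarith
            have hΦ : ∀ τ, Φ s τ = if τ ∈ disjointHoods m N h then 1 else 0 := fun τ =>
              if_congr (and_iff_right hd) rfl rfl
            simp only [hΦ, mul_ite, mul_one, mul_zero]
            rw [← Finset.sum_filter, Finset.filter_mem_eq_inter, Finset.univ_inter]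
            calc B ≤ ∑ τ ∈ disjointHoods m N h, (peq q K P p * (1 - 2 * m ^ 2 * x)) ^ (h * m) *
                  (1 - m * peq q K P p) ^ (N - h * m) := by
                  rw [Finset.sum_const, nsmul_eq_mul, card_disjointHoods_real, hB,
                    mul_assoc (_ * _)]
                  refine mul_le_mul ?_ (mul_le_mul_of_nonneg_left
                    (pow_le_pow_of_le_one hb0 hb0' (Nat.sub_le _ _)) (by positivity))
                    (by positivity) (by positivity)
                  refine mul_le_mul_of_nonneg_left ?_ (by positivity)
                  rw [← Nat.cast_sub hN]
                  exact_mod_cast (Nat.pow_le_pow_left (by omega) _).trans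
                    (Nat.pow_sub_le_descFactorial N (h * m))
              _ ≤ _ := by
                  refine Finset.sum_le_sum fun τ hτ => ?_
                  rw [← prod_ite_nonempty hτ]
                  refine Finset.prod_le_prod (fun j _ => by split_ifs <;> assumption) fun j _ => ?_
                  split_ifs with hj
                  · obtain ⟨i, hi⟩ := exists_eq_singleton_of_mem_disjointHoods hτ hj
                    rw [hi]
                    exact h1 i
                  · rw [not_not.1 hj]
                    exact le_nbhdLaw_empty hp0 hp1 hKP hs
          · rw [if_neg hd, mul_zero]
            refine Finset.sum_nonneg fun τ _ =>
              mul_nonneg (Finset.prod_nonneg fun j _ => hπ _) ?_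
            simp only [Φ]
            split_ifs <;> norm_num
        · push Not at hs
          obtain ⟨i, hi⟩ := hs
          have : ∏ i, ringWeight K P (s i) = 0 :=
            Finset.prod_eq_zero (Finset.mem_univ i) (by simp [ringWeight, hi])
          simp [this]
    _ = ∑ ω : Config (m + N) P, weight (m + N) K P p ω *
          Φ (fun i => ω.1 (Fin.castAdd N i)) (nbhds q ω) := (sum_weight_mul q K P p m N Φ).symm
    _ ≤ _ := by
        refine Finset.sum_le_sum fun ω _ => ?_
        have hw := weight_nonneg (K := K) hp0 hp1 ω
        have hind : 0 ≤ Set.indicator {ω : Config (m + N) P |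
            ∀ i : Fin (m + N), (i : ℕ) < m → degree q (m + N) P ω i = h}
            (weight (m + N) K P p) ω := Set.indicator_nonneg (fun ω _ => weight_nonneg hp0 hp1 ω) ω
        simp only [Φ]
        split_ifs with hω
        · rw [mul_one, Set.indicator_of_mem]
          intro i hi
          have hcast : i = Fin.castAdd N ⟨i, hi⟩ := rfl
          rw [hcast, degree_eq_card hq ω hω.1]
          have := hω.2
          simp only [disjointHoods, Finset.mem_filter, Finset.mem_univ, true_and] at this
          exact this.2 _
        · rw [mul_zero]
          exact hind

end Bounds

section Ratio

variable {q K P m N h : ℕ} {p l : ℝ}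

lemma prob_degree_div_le (hq : 1 ≤ q) (hK : 1 ≤ K) (hKP : K ≤ P) (hp0 : 0 ≤ p) (hp1 : p ≤ 1)
    (hx : (K : ℝ) ^ 2 / P ≤ 1 / 2) (hN : h * m ≤ N)
    (hl : l = ((m + N : ℕ) : ℝ) * peq q K P p) (hl0 : 0 < l) (hy : 1 ≤ (m : ℝ) * l) :
    prob (m + N) K P p {ω | ∀ i : Fin (m + N), (i : ℕ) < m → degree q (m + N) P ω i = h} /
        (((Nat.factorial h : ℝ) ^ m)⁻¹ * l ^ (h * m) * Real.exp (-(m * l))) ≤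
      (1 + (Nat.factorial h : ℝ) ^ m * ((h * m : ℕ) * (m : ℝ) ^ (h * m - 1)) / l) *
      (Real.exp ((m + (h * m : ℕ)) * (m * peq q K P p) +
        2 * m ^ 2 * (p * l * ((K : ℝ) ^ 2 / P))) *
      (1 + (m : ℝ) ^ 2 * (Real.exp ((Real.exp (2 * m ^ 2 * q * (p * l) / K) - 1) *
        ((K : ℝ) ^ 2 / P)) - 1))) := by
  rw [div_le_iff₀ (by positivity)]
  refine (prob_degree_le hq hK hKP hp0 hp1 hx hN hl hy).trans (le_of_eq ?_)
  have hf : ((Nat.factorial h : ℝ) ^ m) ≠ 0 := by positivity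
  have h1 : ((h * m : ℕ) : ℝ) * (m * l) ^ (h * m - 1) =
      (Nat.factorial h : ℝ) ^ m * ((h * m : ℕ) * (m : ℝ) ^ (h * m - 1)) / l *
        (((Nat.factorial h : ℝ) ^ m)⁻¹ * l ^ (h * m)) := by
    rcases Nat.eq_zero_or_pos (h * m) with h0 | h0
    · simp [h0]
    · obtain ⟨r, hr⟩ := Nat.exists_eq_succ_of_ne_zero h0.ne'
      rw [hr, Nat.succ_sub_one, pow_succ, mul_pow]
      field_simp
  have h2 : (m : ℝ) ^ 2 * (2 * p * l * q / K) = 2 * m ^ 2 * q * (p * l) / K := by ring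
  rw [h1, h2, add_assoc, Real.exp_add,
    show 2 * p * l * (m ^ 2 * ((K : ℝ) ^ 2 / P)) = 2 * m ^ 2 * (p * l * ((K : ℝ) ^ 2 / P)) by ring]
  ring

lemma one_sub_mul_sq_mul_exp_le {y : ℝ} (hy0 : 0 ≤ y) (hy1 : y ≤ 1) (n : ℕ) :
    (1 - n * y ^ 2) * Real.exp (-(n * y)) ≤ (1 - y) ^ n := by
  have h1 : 1 - n * y ^ 2 ≤ (1 - y ^ 2) ^ n := by
    have := one_add_mul_le_pow (a := -y ^ 2) (by nlinarith) n
    calc 1 - n * y ^ 2 = 1 + n * -y ^ 2 := by ring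
      _ ≤ (1 + -y ^ 2) ^ n := this
      _ = (1 - y ^ 2) ^ n := by ring
  have h2 : 1 - y ^ 2 ≤ (1 - y) * Real.exp y := by
    have := mul_le_mul_of_nonneg_left (Real.add_one_le_exp y) (sub_nonneg.2 hy1)
    linarith
  calc (1 - n * y ^ 2) * Real.exp (-(n * y))
      ≤ ((1 - y) * Real.exp y) ^ n * Real.exp (-(n * y)) :=
        mul_le_mul_of_nonneg_right (h1.trans (pow_le_pow_left₀ (by nlinarith) h2 n))
          (Real.exp_pos _).le
    _ = (1 - y) ^ n := by
        rw [mul_pow, ← Real.exp_nat_mul, mul_assoc, ← Real.exp_add, add_neg_cancel, Real.exp_zero,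
          mul_one]

lemma le_prob_degree_div (hq : 1 ≤ q) (hK : 1 ≤ K) (hKP : K ≤ P) (hp0 : 0 ≤ p) (hp1 : p ≤ 1)
    (hx : (K : ℝ) ^ 2 / P ≤ 1 / 2) (hx' : 2 * m ^ 2 * ((K : ℝ) ^ 2 / P) ≤ 1)
    (hmp : m * peq q K P p ≤ 1) (hN : h * m ≤ N)
    (hl : l = ((m + N : ℕ) : ℝ) * peq q K P p) (hl0 : 0 < l)
    (hE : 0 ≤ 1 - (m : ℝ) ^ 2 * (Real.exp ((Real.exp 1 - 1) * ((K : ℝ) ^ 2 / P)) - 1)) :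
    (1 - (m + (h * m : ℕ)) / ((m + N : ℕ) : ℝ)) ^ (h * m) *
      (1 - 2 * m ^ 2 * ((K : ℝ) ^ 2 / P)) ^ (h * m) *
      (1 - m ^ 2 * (l ^ 2 / ((m + N : ℕ) : ℝ))) *
      (1 - (m : ℝ) ^ 2 * (Real.exp ((Real.exp 1 - 1) * ((K : ℝ) ^ 2 / P)) - 1)) ≤
    prob (m + N) K P p {ω | ∀ i : Fin (m + N), (i : ℕ) < m → degree q (m + N) P ω i = h} /
        (((Nat.factorial h : ℝ) ^ m)⁻¹ * l ^ (h * m) * Real.exp (-(m * l))) := by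
  have hpe : 0 ≤ peq q K P p := mul_nonneg hp0 (psq_nonneg hKP)
  have hn : ((m + N : ℕ) : ℝ) ≠ 0 := by
    rintro h0
    rw [h0, zero_mul] at hl
    exact hl0.ne' hl
  rw [le_div_iff₀ (by positivity)]
  refine le_trans ?_ (le_prob_degree hq hK hKP hp0 hp1 hx hx' hmp hN)
  have hmp0 : 0 ≤ m * peq q K P p := by positivity
  have h1 := one_sub_mul_sq_mul_exp_le hmp0 hmp (m + N)
  have h2 : (1 - m * peq q K P p) ^ (m + N) ≤ (1 - m * peq q K P p) ^ N :=
    pow_le_pow_of_le_one (by linarith) (by linarith) (Nat.le_add_left _ _)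
  have h3 : (((m + N : ℕ) : ℝ)) * (m * peq q K P p) ^ 2 =
      m ^ 2 * (l ^ 2 / ((m + N : ℕ) : ℝ)) := by
    rw [hl]
    field_simp
  have h4 : ((m + N : ℕ) : ℝ) * (m * peq q K P p) = m * l := by
    rw [hl]
    ring
  rw [h3, h4] at h1
  have h5 : (1 - (m + (h * m : ℕ)) / ((m + N : ℕ) : ℝ)) * l =
      ((N : ℝ) - (h * m : ℕ)) * peq q K P p := by
    rw [hl]
    field_simp
    push_cast
    ring
  have h6 : (0 : ℝ) ≤ (N : ℝ) - (h * m : ℕ) := sub_nonneg.2 (by exact_mod_cast hN)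
  have h7 : (0 : ℝ) ≤ 1 - 2 * m ^ 2 * ((K : ℝ) ^ 2 / P) := sub_nonneg.2 hx'
  refine le_of_eq_of_le ?_ (mul_le_mul_of_nonneg_right (mul_le_mul_of_nonneg_left (h1.trans h2)
    (by positivity)) hE)
  rw [mul_pow (peq q K P p)]
  calc _ = ((Nat.factorial h : ℝ) ^ m)⁻¹ *
        ((1 - (m + (h * m : ℕ)) / ((m + N : ℕ) : ℝ)) * l) ^ (h * m) *
        (1 - 2 * m ^ 2 * ((K : ℝ) ^ 2 / P)) ^ (h * m) *
        ((1 - m ^ 2 * (l ^ 2 / ((m + N : ℕ) : ℝ))) * Real.exp (-(m * l))) *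
        (1 - (m : ℝ) ^ 2 * (Real.exp ((Real.exp 1 - 1) * ((K : ℝ) ^ 2 / P)) - 1)) := by
        rw [mul_pow]
        ring
    _ = _ := by
        rw [h5, mul_pow]
        ring

end Ratio

section Asymptotics

variable {l : ℕ → ℝ}

lemma eventually_mem_Icc_log
    (hl : ∃ C : ℝ, ∀ᶠ n : ℕ in atTop, |(l n - Real.log n) / Real.log (Real.log n)| ≤ C) :
    ∀ᶠ n : ℕ in atTop, Real.log n / 2 ≤ l n ∧ l n ≤ 3 / 2 * Real.log n := by
  obtain ⟨C, hC⟩ := hl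
  have hlog : Tendsto (fun n : ℕ => Real.log n) atTop atTop :=
    Real.tendsto_log_atTop.comp tendsto_natCast_atTop_atTop
  have hc : 0 < 1 / (2 * (|C| + 1)) := by positivity
  filter_upwards [hC, (Real.isLittleO_log_id_atTop.comp_tendsto hlog).def hc,
    hlog.eventually_gt_atTop 1] with n h1 h2 h3
  have h4 : 0 < Real.log (Real.log n) := Real.log_pos h3
  simp only [Function.comp_apply, id, Real.norm_eq_abs, abs_of_pos h4,
    abs_of_pos (zero_lt_one.trans h3)] at h2
  rw [abs_div, abs_of_pos h4, div_le_iff₀ h4] at h1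
  have h5 : |l n - Real.log n| ≤ Real.log n / 2 := by
    calc _ ≤ C * Real.log (Real.log n) := h1
      _ ≤ (|C| + 1) * Real.log (Real.log n) :=
          mul_le_mul_of_nonneg_right (by linarith [le_abs_self C]) h4.le
      _ ≤ (|C| + 1) * (1 / (2 * (|C| + 1)) * Real.log n) :=
          mul_le_mul_of_nonneg_left h2 (by positivity)
      _ = Real.log n / 2 := by
          have : |C| + 1 ≠ 0 := by positivity
          field_simp
  have := abs_le.1 h5
  constructor <;> linarith

lemma tendsto_pow_mul_exp_div_natCast (hl : Tendsto l atTop atTop)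
    (hlog : ∀ᶠ n : ℕ in atTop, l n ≤ 3 / 2 * Real.log n) (k : ℕ) :
    Tendsto (fun n : ℕ => l n ^ k * Real.exp (l n / 2) / n) atTop (nhds 0) := by
  have h1 := (tendsto_rpow_mul_exp_neg_mul_atTop_nhds_zero k (1 / 6) (by norm_num)).comp hl
  refine squeeze_zero' ?_ ?_ h1
  · filter_upwards [hl.eventually_ge_atTop 0] with n hn
    positivity
  · filter_upwards [hl.eventually_ge_atTop 0, hlog, eventually_gt_atTop 0] with n h0 h2 h3
    have hn : (0 : ℝ) < n := by exact_mod_cast h3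
    simp only [Function.comp_apply, Real.rpow_natCast]
    rw [mul_div_assoc]
    refine mul_le_mul_of_nonneg_left ?_ (by positivity)
    rw [div_le_iff₀ hn]
    nth_rw 1 [← Real.exp_log hn]
    rw [← Real.exp_add, Real.exp_le_exp]
    linarith

lemma tendsto_pow_div_natCast (hl : Tendsto l atTop atTop)
    (hlog : ∀ᶠ n : ℕ in atTop, l n ≤ 3 / 2 * Real.log n) (k : ℕ) :
    Tendsto (fun n : ℕ => l n ^ k / n) atTop (nhds 0) := by
  refine squeeze_zero' ?_ ?_ (tendsto_pow_mul_exp_div_natCast hl hlog k)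
  · filter_upwards [hl.eventually_ge_atTop 0] with n hn
    positivity
  · filter_upwards [hl.eventually_ge_atTop 0] with n hn
    gcongr
    exact le_mul_of_one_le_right (by positivity) (Real.one_le_exp (by positivity))

lemma tendsto_zero_of_tendsto_pow {α : Type*} {f : Filter α} {y : α → ℝ} {q : ℕ} (hq : q ≠ 0)
    (hy0 : ∀ᶠ a in f, 0 ≤ y a) (hy : Tendsto (fun a => y a ^ q) f (nhds 0)) :
    Tendsto y f (nhds 0) := by
  have hq' : (0 : ℝ) < (q : ℝ)⁻¹ := by positivity
  have h1 := hy.rpow_const (Or.inr hq'.le)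
  rw [Real.zero_rpow hq'.ne'] at h1
  exact h1.congr' (hy0.mono fun a ha => Real.pow_rpow_inv_natCast ha hq)

variable {p x : ℕ → ℝ} {q : ℕ} {c : ℝ}

lemma tendsto_mul_mul_of_mul_pow_le (hq : 1 ≤ q) (hp : ∀ n, p n ∈ Set.Ioc (0 : ℝ) 1)
    (hx0 : ∀ n, 0 ≤ x n) (hl : Tendsto l atTop atTop)
    (hlog : ∀ᶠ n : ℕ in atTop, l n ≤ 3 / 2 * Real.log n)
    (hpx : ∀ᶠ n : ℕ in atTop, p n * x n ^ q ≤ c * (l n / n)) :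
    Tendsto (fun n => p n * l n * x n) atTop (nhds 0) := by
  refine tendsto_zero_of_tendsto_pow (by omega : q ≠ 0) ?_ ?_
  · filter_upwards [hl.eventually_ge_atTop 0] with n hn
    exact mul_nonneg (mul_nonneg (hp n).1.le hn) (hx0 n)
  · have h1 := (tendsto_pow_div_natCast hl hlog (q + 1)).const_mul c
    rw [mul_zero] at h1
    refine squeeze_zero' ?_ ?_ h1
    · filter_upwards [hl.eventually_ge_atTop 0] with n hn
      exact pow_nonneg (mul_nonneg (mul_nonneg (hp n).1.le hn) (hx0 n)) _
    · filter_upwards [hl.eventually_ge_atTop 0, hpx] with n hn h2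
      have h3 : p n ^ q ≤ p n := pow_le_of_le_one (hp n).1.le (hp n).2 (by omega)
      have hxq := pow_nonneg (hx0 n) q
      calc (p n * l n * x n) ^ q = p n ^ q * x n ^ q * l n ^ q := by ring
        _ ≤ p n * x n ^ q * l n ^ q := by gcongr
        _ ≤ c * (l n / n) * l n ^ q := by gcongr
        _ = c * (l n ^ (q + 1) / n) := by ring

lemma tendsto_exp_mul_of_mul_pow_le (hq : 1 ≤ q) (hp : ∀ n, p n ∈ Set.Ioc (0 : ℝ) 1)
    (hx0 : ∀ n, 0 ≤ x n) (hx : Tendsto x atTop (nhds 0)) (hl : Tendsto l atTop atTop)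
    (hlog : ∀ᶠ n : ℕ in atTop, l n ≤ 3 / 2 * Real.log n)
    (hpx : ∀ᶠ n : ℕ in atTop, p n * x n ^ q ≤ c * (l n / n)) {κ : ℕ → ℝ}
    (hκ : Tendsto κ atTop atTop) {b : ℝ} (hb : 0 ≤ b) :
    Tendsto (fun n => Real.exp (b * (p n * l n) / κ n) * x n) atTop (nhds 0) := by
  refine tendsto_zero_of_tendsto_pow (by omega : q ≠ 0)
    (Eventually.of_forall fun n => mul_nonneg (Real.exp_pos _).le (hx0 n)) ?_
  have h1 := ((hx.pow q).const_mul (Real.exp b ^ q)).add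
    ((tendsto_pow_mul_exp_div_natCast hl hlog 2).const_mul c)
  rw [zero_pow (by omega), mul_zero, mul_zero, add_zero] at h1
  refine squeeze_zero' (Eventually.of_forall fun n =>
    pow_nonneg (mul_nonneg (Real.exp_pos _).le (hx0 n)) _) ?_ h1
  filter_upwards [hl.eventually_ge_atTop 0, hpx, hκ.eventually_ge_atTop 1,
    hκ.eventually_ge_atTop (2 * (q * b))] with n hn h2 h3 h4
  have hκ0 : 0 < κ n := by linarith
  have hxq := pow_nonneg (hx0 n) q
  have h5 : 0 ≤ c * (l n / n) := le_trans (mul_nonneg (hp n).1.le hxq) h2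
  have h6 : 0 ≤ p n * l n := mul_nonneg (hp n).1.le hn
  have h7 : c * (l n ^ 2 * Real.exp (l n / 2) / n) =
      Real.exp (l n / 2) * (l n * (c * (l n / n))) := by ring
  rw [h7, mul_pow]
  rcases le_total (p n * l n) 1 with h8 | h8
  · refine le_add_of_le_of_nonneg ?_ (by positivity)
    gcongr
    rw [div_le_iff₀ hκ0]
    gcongr
    linarith
  · refine le_add_of_nonneg_of_le (by positivity) ?_
    rw [← Real.exp_nat_mul]
    refine mul_le_mul (Real.exp_le_exp.2 ?_) ?_ hxq (Real.exp_pos _).le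
    · rw [← mul_div_assoc, div_le_iff₀ hκ0]
      have : p n * l n ≤ l n := mul_le_of_le_one_left hn (hp n).2
      calc q * (b * (p n * l n)) = (q * b) * (p n * l n) := by ring
        _ ≤ (q * b) * l n := by gcongr
        _ = l n / 2 * (2 * (q * b)) := by ring
        _ ≤ l n / 2 * κ n := by gcongr
    · calc x n ^ q ≤ (p n * l n) * x n ^ q := le_mul_of_one_le_left hxq h8
        _ = l n * (p n * x n ^ q) := by ring
        _ ≤ _ := by gcongr

end Asymptotics

/-- if `K_n → ∞`, `K_n²/P_n → 0` and `(n p_{e,q}(n) − ln n)/ln ln n`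
is bounded, then for fixed `m ≥ 1` and `h ≥ 0`, the probability that the first
`m` vertices all have degree exactly `h` is asymptotically equivalent to
`(h!)^{−m} (n p_{e,q}(n))^{hm} e^{−m n p_{e,q}(n)}`. -/
theorem prob_first_m_vertices_have_degree_h
    (q : ℕ) (hq : 1 ≤ q) (m : ℕ) (hm : 1 ≤ m) (h : ℕ)
    (K P : ℕ → ℕ) (p : ℕ → ℝ)
    (hK1 : ∀ n, 1 ≤ K n) (hKP : ∀ n, K n ≤ P n)
    (hp : ∀ n, p n ∈ Set.Ioc (0 : ℝ) 1)
    (hKinf : Tendsto (fun n => (K n : ℝ)) atTop atTop)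
    (hKsqP : Tendsto (fun n => ((K n : ℝ)) ^ 2 / (P n : ℝ)) atTop (nhds 0))
    (hbounded : ∃ C : ℝ, ∀ᶠ (n : ℕ) in atTop,
      |((n : ℝ) * peq q (K n) (P n) (p n) - Real.log (n : ℝ)) / Real.log (Real.log (n : ℝ))| ≤ C) :
    Tendsto (fun n =>
        prob n (K n) (P n) (p n)
            {ω | ∀ i : Fin n, (i : ℕ) < m → degree q n (P n) ω i = h} /
          (((Nat.factorial h : ℝ) ^ m)⁻¹ *
            ((n : ℝ) * peq q (K n) (P n) (p n)) ^ (h * m) *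
            Real.exp (-((m : ℝ) * ((n : ℝ) * peq q (K n) (P n) (p n))))))
      atTop (nhds 1) := by
  set x : ℕ → ℝ := fun n => (K n : ℝ) ^ 2 / (P n : ℝ)
  have hx0 : ∀ n, 0 ≤ x n := fun n => div_nonneg (by positivity) (by positivity)
  set l : ℕ → ℝ := fun n => (n : ℝ) * peq q (K n) (P n) (p n) with hl
  have hIcc := eventually_mem_Icc_log hbounded
  have hlog : ∀ᶠ n : ℕ in atTop, l n ≤ 3 / 2 * Real.log n := hIcc.mono fun n hn => hn.2
  have hlinf : Tendsto l atTop atTop := tendsto_atTop_mono' _ (hIcc.mono fun n hn => hn.1)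
    ((Real.tendsto_log_atTop.comp tendsto_natCast_atTop_atTop).atTop_div_const two_pos)
  have hpe : ∀ᶠ n : ℕ in atTop, peq q (K n) (P n) (p n) = l n / n := by
    filter_upwards [eventually_gt_atTop 0] with n hn
    have : (n : ℝ) ≠ 0 := by positivity
    simp only [hl]
    field_simp
  have hpe0 : Tendsto (fun n => peq q (K n) (P n) (p n)) atTop (nhds 0) := by
    refine (tendsto_pow_div_natCast hlinf hlog 1).congr' ?_
    filter_upwards [hpe] with n hn
    rw [hn, pow_one]
  have hxhalf : ∀ᶠ n in atTop, x n ≤ 1 / 2 := hKsqP.eventually_le_const (by norm_num)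
  have hpx : ∀ᶠ n in atTop, p n * x n ^ q ≤ 4 ^ q * Nat.factorial q * 2 * (l n / n) := by
    filter_upwards [hxhalf, hpe, hKinf.eventually_ge_atTop ((2 * q : ℕ) : ℝ)] with n h1 h2 h3
    rw [← h2, peq]
    calc p n * x n ^ q ≤ p n * (4 ^ q * Nat.factorial q * (2 * psq q (K n) (P n))) := by
          refine mul_le_mul_of_nonneg_left ?_ (hp n).1.le
          refine (pow_le_meanShared (hKP n) (by exact_mod_cast h3)).trans ?_
          exact mul_le_mul_of_nonneg_left (meanShared_le_two_mul (hKP n) h1) (by positivity)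
      _ = _ := by ring
  have hplx := tendsto_mul_mul_of_mul_pow_le (x := x) hq hp hx0 hlinf hlog hpx
  have hexp := tendsto_exp_mul_of_mul_pow_le (x := x) hq hp hx0 hKsqP hlinf hlog hpx hKinf
    (b := 2 * m ^ 2 * q) (by positivity)
  have hexp_sub : ∀ {u : ℕ → ℝ}, Tendsto u atTop (nhds 0) →
      Tendsto (fun n => (m : ℝ) ^ 2 * (Real.exp (u n) - 1)) atTop (nhds 0) := fun {u} hu => by
    simpa using (((Real.continuous_exp.tendsto 0).comp hu).sub_const 1).const_mul ((m : ℝ) ^ 2)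
  have hupper : Tendsto (fun n =>
      (1 + (Nat.factorial h : ℝ) ^ m * ((h * m : ℕ) * (m : ℝ) ^ (h * m - 1)) / l n) *
      (Real.exp ((m + (h * m : ℕ)) * (m * peq q (K n) (P n) (p n)) +
        2 * m ^ 2 * (p n * l n * x n)) *
      (1 + (m : ℝ) ^ 2 * (Real.exp ((Real.exp (2 * m ^ 2 * q * (p n * l n) / K n) - 1) *
        x n) - 1)))) atTop (nhds 1) := by
    have h1 := (hlinf.const_div_atTop
      ((Nat.factorial h : ℝ) ^ m * ((h * m : ℕ) * (m : ℝ) ^ (h * m - 1)))).const_add 1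
    have h2 := (Real.continuous_exp.tendsto _).comp
      (((hpe0.const_mul (m : ℝ)).const_mul ((m : ℝ) + (h * m : ℕ))).add
        (hplx.const_mul (2 * (m : ℝ) ^ 2)))
    have h3 := (hexp_sub (u := fun n =>
      (Real.exp (2 * m ^ 2 * q * (p n * l n) / K n) - 1) * x n)
      (by simpa only [sub_mul, one_mul, sub_zero] using hexp.sub hKsqP)).const_add 1
    simpa using h1.mul (h2.mul h3)
  have hE := (hexp_sub (u := fun n => (Real.exp 1 - 1) * x n)
    (by simpa using hKsqP.const_mul (Real.exp 1 - 1))).const_sub 1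
  have hlower : Tendsto (fun n : ℕ =>
      (1 - (m + (h * m : ℕ)) / (n : ℝ)) ^ (h * m) * (1 - 2 * m ^ 2 * x n) ^ (h * m) *
      (1 - m ^ 2 * (l n ^ 2 / (n : ℝ))) *
      (1 - (m : ℝ) ^ 2 * (Real.exp ((Real.exp 1 - 1) * x n) - 1))) atTop (nhds 1) := by
    have h1 := ((tendsto_const_div_atTop_nhds_zero_nat
      ((m : ℝ) + (h * m : ℕ))).const_sub 1).pow (h * m)
    have h2 := ((hKsqP.const_mul (2 * (m : ℝ) ^ 2)).const_sub 1).pow (h * m)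
    have h3 := ((tendsto_pow_div_natCast hlinf hlog 2).const_mul ((m : ℝ) ^ 2)).const_sub 1
    simpa using ((h1.mul h2).mul h3).mul hE
  have hm1 : (1 : ℝ) ≤ m := by exact_mod_cast hm
  refine tendsto_of_tendsto_of_tendsto_of_le_of_le' hlower hupper ?_ ?_
  · filter_upwards [eventually_ge_atTop (m + h * m), hxhalf, hlinf.eventually_gt_atTop 0,
      (hKsqP.const_mul (2 * (m : ℝ) ^ 2)).eventually_le_const (by simp : _ < (1 : ℝ)),
      (hpe0.const_mul (m : ℝ)).eventually_le_const (by simp : _ < (1 : ℝ)),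
      hE.eventually_const_le (by simp : (0 : ℝ) < _)] with n h1 h2 h3 h4 h5 h6
    obtain ⟨N, rfl⟩ : ∃ N, n = m + N := ⟨n - m, by omega⟩
    exact le_prob_degree_div hq (hK1 _) (hKP _) (hp _).1.le (hp _).2 h2 h4 h5 (by omega) rfl h3 h6
  · filter_upwards [eventually_ge_atTop (m + h * m), hxhalf,
      hlinf.eventually_ge_atTop 1] with n h1 h2 h3
    obtain ⟨N, rfl⟩ : ∃ N, n = m + N := ⟨n - m, by omega⟩
    exact prob_degree_div_le hq (hK1 _) (hKP _) (hp _).1.le (hp _).2 h2 (by omega) rfl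
      (by linarith) (by nlinarith)
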